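/- Let Γ be a planar y-monotone poly-line drawing of height h of a simple graph G. Then there exist a simple graph G′ containing G as a subgraph, obtained from G by adding three new vertices and additional edges, such that G′ is triangulated, together with a planar y-monotone poly-line drawing of G′ of height h + 2 in which every vertex of G has the same x-coordinate as in Γ and y-coordinate exactly one larger than in Γ. -/

import Mathlib

open Set

noncomputable section

/-- Points of the plane. -/
abbrev Pt : Type := ℝ × ℝ

/-- The image (set of points) of a polygonal chain given by its list of breakpoints. -/
def chainSet : List Pt → Set Pt
  | [] => ∅
  | [p] => {p}
  | p :: q :: rest => segment ℝ p q ∪ chainSet (q :: rest)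

/-- The bends (interior junction points) of a polygonal chain. -/
def chainBends (l : List Pt) : List Pt := (l.drop 1).dropLast

/-- `S` is the image of a simple (injective) curve from `a` to `b`. -/
def IsSimpleArc (S : Set Pt) (a b : Pt) : Prop :=
  ∃ γ : ℝ → Pt, ContinuousOn γ (Icc (0:ℝ) 1) ∧ InjOn γ (Icc (0:ℝ) 1) ∧
    γ '' Icc (0:ℝ) 1 = S ∧ γ 0 = a ∧ γ 1 = b

/-- A poly-line drawing of a simple graph `G`: an injective placement of the vertices
together with, for each edge, a simple polygonal arc joining the endpoints. -/
structure PolyDrawing {V : Type} (G : SimpleGraph V) where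
  pos : V → Pt
  pos_inj : Function.Injective pos
  arc : Sym2 V → List Pt
  arc_ends : ∀ u v : V, G.Adj u v →
    ((arc s(u, v)).head? = some (pos u) ∧ (arc s(u, v)).getLast? = some (pos v)) ∨
    ((arc s(u, v)).head? = some (pos v) ∧ (arc s(u, v)).getLast? = some (pos u))
  arc_simple : ∀ u v : V, G.Adj u v →
    IsSimpleArc (chainSet (arc s(u, v))) (pos u) (pos v)

namespace PolyDrawing

variable {V : Type} {G : SimpleGraph V}

/-- The set of points used by the arc of an edge. -/
def edgePts (Γ : PolyDrawing G) (e : Sym2 V) : Set Pt := chainSet (Γ.arc e)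

/-- Planarity: no vertex point lies on the arc of a non-incident edge, and arcs of
distinct edges meet only in images of common endpoints. -/
def IsPlanar (Γ : PolyDrawing G) : Prop :=
  (∀ v : V, ∀ e ∈ G.edgeSet, v ∉ e → Γ.pos v ∉ Γ.edgePts e) ∧
  (∀ e ∈ G.edgeSet, ∀ f ∈ G.edgeSet, e ≠ f →
    ∀ p ∈ Γ.edgePts e ∩ Γ.edgePts f, ∃ w : V, w ∈ e ∧ w ∈ f ∧ p = Γ.pos w)

/-- `y`-monotone: along every edge arc the `y`-coordinate varies weakly monotonically. -/
def IsYMonotone (Γ : PolyDrawing G) : Prop :=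
  ∀ e ∈ G.edgeSet,
    List.Chain' (· ≤ ·) ((Γ.arc e).map Prod.snd) ∨
    List.Chain' (· ≥ ·) ((Γ.arc e).map Prod.snd)

/-- The drawing has height `h`: every vertex and every bend has an integer
`y`-coordinate in `{1, …, h}`. -/
def HasHeight (Γ : PolyDrawing G) (h : ℕ) : Prop :=
  (∀ v : V, ∃ k : ℤ, 1 ≤ k ∧ k ≤ (h : ℤ) ∧ (Γ.pos v).2 = (k : ℝ)) ∧
  (∀ e ∈ G.edgeSet, ∀ p ∈ chainBends (Γ.arc e), ∃ k : ℤ, 1 ≤ k ∧ k ≤ (h : ℤ) ∧ p.2 = (k : ℝ))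

/-- All vertices and bends have integer `y`-coordinates. -/
def IntegerY (Γ : PolyDrawing G) : Prop :=
  (∀ v : V, ∃ k : ℤ, (Γ.pos v).2 = (k : ℝ)) ∧
  (∀ e ∈ G.edgeSet, ∀ p ∈ chainBends (Γ.arc e), ∃ k : ℤ, p.2 = (k : ℝ))

/-- The set of all points of the drawing (vertex points and edge arcs). -/
def image (Γ : PolyDrawing G) : Set Pt :=
  Set.range Γ.pos ∪ ⋃ e ∈ G.edgeSet, Γ.edgePts e

/-- The union of the unbounded connected components of the complement of the drawing. -/
def outerRegion (Γ : PolyDrawing G) : Set Pt :=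
  {p | p ∉ Γ.image ∧ ¬ Bornology.IsBounded (connectedComponentIn Γ.imageᶜ p)}

/-- A vertex is inner if its point does not lie on the boundary of the unbounded
connected component of the complement of the drawing. -/
def IsInner (Γ : PolyDrawing G) (v : V) : Prop :=
  Γ.pos v ∉ frontier Γ.outerRegion

/-- Number of incoming edges at `v` (edges whose other endpoint is weakly below `v`;
horizontal edges count as incoming). -/
def indeg (Γ : PolyDrawing G) (v : V) : ℕ :=
  {w : V | G.Adj v w ∧ (Γ.pos w).2 ≤ (Γ.pos v).2}.ncard

/-- Number of outgoing edges at `v` (edges whose other endpoint is weakly above `v`;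
horizontal edges count as outgoing). -/
def outdeg (Γ : PolyDrawing G) (v : V) : ℕ :=
  {w : V | G.Adj v w ∧ (Γ.pos v).2 ≤ (Γ.pos w).2}.ncard

/-- The set of points drawn for an element (vertex or edge) of the graph. -/
def drawSet (Γ : PolyDrawing G) : V ⊕ ↥G.edgeSet → Set Pt
  | Sum.inl v => {Γ.pos v}
  | Sum.inr e => Γ.edgePts e

end PolyDrawing

/-- A straight-line drawing of a simple graph: an injective placement of the vertices;
each edge is drawn as the closed segment between its endpoints. -/
structure StraightDrawing {V : Type} (G : SimpleGraph V) where
  pos : V → Pt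
  pos_inj : Function.Injective pos

namespace StraightDrawing

variable {V : Type} {G : SimpleGraph V}

/-- The closed segment representing an edge. -/
def edgePts (Γ : StraightDrawing G) (e : Sym2 V) : Set Pt :=
  Sym2.lift ⟨fun u v => segment ℝ (Γ.pos u) (Γ.pos v),
    fun u v => segment_symm (𝕜 := ℝ) (Γ.pos u) (Γ.pos v)⟩ e

/-- Planarity of a straight-line drawing. -/
def IsPlanar (Γ : StraightDrawing G) : Prop :=
  (∀ v : V, ∀ e ∈ G.edgeSet, v ∉ e → Γ.pos v ∉ Γ.edgePts e) ∧
  (∀ e ∈ G.edgeSet, ∀ f ∈ G.edgeSet, e ≠ f →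
    ∀ p ∈ Γ.edgePts e ∩ Γ.edgePts f, ∃ w : V, w ∈ e ∧ w ∈ f ∧ p = Γ.pos w)

/-- Every vertex has an integer `y`-coordinate in `{1, …, h}`. -/
def HeightLe (Γ : StraightDrawing G) (h : ℕ) : Prop :=
  ∀ v : V, ∃ k : ℤ, 1 ≤ k ∧ k ≤ (h : ℤ) ∧ (Γ.pos v).2 = (k : ℝ)

/-- All vertices lie on integer grid points. -/
def IsGrid (Γ : StraightDrawing G) : Prop :=
  ∀ v : V, ∃ p : ℤ × ℤ, Γ.pos v = ((p.1 : ℝ), (p.2 : ℝ))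

/-- The set of points drawn for an element (vertex or edge) of the graph. -/
def drawSet (Γ : StraightDrawing G) : V ⊕ ↥G.edgeSet → Set Pt
  | Sum.inl v => {Γ.pos v}
  | Sum.inr e => Γ.edgePts e

end StraightDrawing

/-- The intersection of a set of points with the horizontal line `y = r`,
recorded as a set of `x`-coordinates. -/
def rowSlice (S : Set Pt) (r : ℝ) : Set ℝ := {x : ℝ | (x, r) ∈ S}

/-- Two drawings (given by the sets drawn for each vertex/edge element) have the same
left-to-right order in each row: for every integer row `r` and elements `a`, `b` both
meeting row `r` in both drawings, the drawing of `a` lies entirely strictly to the left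
of that of `b` in one drawing iff it does in the other. -/
def SameRowOrder {α : Type} (D D' : α → Set Pt) : Prop :=
  ∀ r : ℤ, ∀ a b : α,
    (rowSlice (D a) (r : ℝ)).Nonempty → (rowSlice (D b) (r : ℝ)).Nonempty →
    (rowSlice (D' a) (r : ℝ)).Nonempty → (rowSlice (D' b) (r : ℝ)).Nonempty →
    ((∀ x ∈ rowSlice (D a) (r : ℝ), ∀ y ∈ rowSlice (D b) (r : ℝ), x < y) ↔
     (∀ x ∈ rowSlice (D' a) (r : ℝ), ∀ y ∈ rowSlice (D' b) (r : ℝ), x < y))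

/-- A simple graph on `n ≥ 3` vertices is triangulated (maximal planar) if it admits a
planar poly-line drawing and has exactly `3n - 6` edges. -/
def IsTriangulated {V : Type} [Fintype V] (G : SimpleGraph V) : Prop :=
  3 ≤ Fintype.card V ∧ G.edgeSet.ncard = 3 * Fintype.card V - 6 ∧
  ∃ Γ : PolyDrawing G, Γ.IsPlanar

/-- Data of a flat visibility representation: a horizontal segment for every vertex
(given by its `y`-coordinate and left/right `x`-coordinates) and a segment (given by
its two endpoints) for every edge. -/
structure VisData (V : Type) where
  ly : V → ℝ
  lx : V → ℝ
  rx : V → ℝ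
  ep1 : Sym2 V → Pt
  ep2 : Sym2 V → Pt

/-- The horizontal segment of a vertex. -/
def VisData.vseg {V : Type} (D : VisData V) (v : V) : Set Pt :=
  segment ℝ (D.lx v, D.ly v) (D.rx v, D.ly v)

/-- The segment of an edge. -/
def VisData.eseg {V : Type} (D : VisData V) (e : Sym2 V) : Set Pt :=
  segment ℝ (D.ep1 e) (D.ep2 e)

/-- `D` is a planar flat visibility representation of `G` of height `h`. -/
def IsFlatVisRep {V : Type} (G : SimpleGraph V) (D : VisData V) (h : ℕ) : Prop :=
  (∀ v : V, D.lx v ≤ D.rx v) ∧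
  (∀ v : V, ∃ k : ℤ, 1 ≤ k ∧ k ≤ (h : ℤ) ∧ D.ly v = (k : ℝ)) ∧
  (∀ e ∈ G.edgeSet, (D.ep1 e).1 = (D.ep2 e).1 ∨ (D.ep1 e).2 = (D.ep2 e).2) ∧
  (∀ e ∈ G.edgeSet, ∀ p ∈ D.eseg e, 1 ≤ p.2 ∧ p.2 ≤ (h : ℝ)) ∧
  (∀ u v : V, G.Adj u v →
    (D.ep1 s(u, v) ∈ D.vseg u ∧ D.ep2 s(u, v) ∈ D.vseg v) ∨
    (D.ep1 s(u, v) ∈ D.vseg v ∧ D.ep2 s(u, v) ∈ D.vseg u)) ∧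
  (∀ u v : V, u ≠ v → Disjoint (D.vseg u) (D.vseg v)) ∧
  (∀ e ∈ G.edgeSet, ∀ w : V, ∀ p ∈ D.eseg e ∩ D.vseg w, p = D.ep1 e ∨ p = D.ep2 e) ∧
  (∀ e ∈ G.edgeSet, ∀ f ∈ G.edgeSet, e ≠ f → ∀ p ∈ D.eseg e ∩ D.eseg f,
    (p = D.ep1 e ∨ p = D.ep2 e) ∧ (p = D.ep1 f ∨ p = D.ep2 f))

end

/-- Combinatorial data of a row-based drawing: every vertex has an integer row and an abscissa,
and every edge joining different rows has an abscissa in each row that it meets. -/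
structure Layout (W : Type) where
  row : W → ℤ
  x : W → ℝ
  G : SimpleGraph W
  X : W × W → ℤ → ℝ

namespace Layout

variable {W : Type}

/-- `e` is an edge directed upwards. -/
def Up (L : Layout W) (e : W × W) : Prop := L.G.Adj e.1 e.2 ∧ L.row e.1 < L.row e.2

/-- The upward edge `e` crosses row `r` strictly between its endpoints. -/
def Pass (L : Layout W) (e : W × W) (r : ℤ) : Prop := L.Up e ∧ L.row e.1 < r ∧ r < L.row e.2

/-- The upward edge `e` crosses the strip between the rows `r` and `r + 1`. -/
def Spans (L : Layout W) (e : W × W) (r : ℤ) : Prop := L.Up e ∧ L.row e.1 ≤ r ∧ r < L.row e.2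

/-- Twice the abscissa of `e` in the middle of the strip between the rows `r` and `r + 1`. -/
def mid (L : Layout W) (e : W × W) (r : ℤ) : ℝ := L.X e r + L.X e (r + 1)

/-- The conditions under which the layout describes a planar drawing. -/
structure Valid (L : Layout W) : Prop where
  inj : ∀ u v, L.row u = L.row v → L.x u = L.x v → u = v
  X_fst : ∀ e, L.Up e → L.X e (L.row e.1) = L.x e.1
  X_snd : ∀ e, L.Up e → L.X e (L.row e.2) = L.x e.2
  pass_vertex : ∀ e w, L.Pass e (L.row w) → L.X e (L.row w) ≠ L.x w
  pass_edge : ∀ e f r, L.Pass e r → L.Pass f r → L.X e r = L.X f r → e = f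
  cross : ∀ e f r, L.Spans e r → L.Spans f r → L.X e r < L.X f r → L.X e (r + 1) ≤ L.X f (r + 1)
  horiz_vertex : ∀ u v w, L.G.Adj u v → L.row u = L.row v → L.row w = L.row u →
    L.x u < L.x w → L.x v ≤ L.x w
  horiz_edge : ∀ u v e, L.G.Adj u v → L.row u = L.row v → L.Pass e (L.row u) →
    L.x u < L.X e (L.row u) → L.x v ≤ L.X e (L.row u)

/-- Reflection at a vertical line. -/
def flipX (L : Layout W) : Layout W where
  row := L.row
  x w := -L.x w
  G := L.G
  X e r := -L.X e r

/-- Reflection at a horizontal line. -/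
def flipY (L : Layout W) : Layout W where
  row w := -L.row w
  x := L.x
  G := L.G
  X e r := L.X e.swap (-r)

lemma flipY_up {L : Layout W} {e : W × W} : L.flipY.Up e ↔ L.Up e.swap := by
  simp [Up, flipY, SimpleGraph.adj_comm]

lemma flipY_pass {L : Layout W} {e : W × W} {r : ℤ} : L.flipY.Pass e r ↔ L.Pass e.swap (-r) := by
  unfold Pass
  rw [flipY_up]
  simp only [flipY, Prod.fst_swap, Prod.snd_swap]
  refine and_congr_right fun _ => ⟨fun h => ?_, fun h => ?_⟩ <;> constructor <;> omega

lemma flipY_spans {L : Layout W} {e : W × W} {r : ℤ} :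
    L.flipY.Spans e r ↔ L.Spans e.swap (-r - 1) := by
  unfold Spans
  rw [flipY_up]
  simp only [flipY, Prod.fst_swap, Prod.snd_swap]
  refine and_congr_right fun _ => ⟨fun h => ?_, fun h => ?_⟩ <;> constructor <;> omega

lemma flipY_mid {L : Layout W} (e : W × W) (r : ℤ) :
    L.flipY.mid e r = L.mid e.swap (-r - 1) := by
  simp only [mid, flipY]
  rw [show -r - 1 + 1 = -r by ring, show -(r + 1) = -r - 1 by ring, add_comm]

lemma flipX_mid {L : Layout W} (e : W × W) (r : ℤ) : L.flipX.mid e r = -L.mid e r := by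
  simp only [mid, flipX]; ring

namespace Valid

variable {L : Layout W}

lemma X_of_fst (hL : L.Valid) {e : W × W} {r : ℤ} (he : L.Up e) (h : L.row e.1 = r) :
    L.X e r = L.x e.1 := h ▸ hL.X_fst e he

lemma X_of_snd (hL : L.Valid) {e : W × W} {r : ℤ} (he : L.Up e) (h : L.row e.2 = r) :
    L.X e r = L.x e.2 := h ▸ hL.X_snd e he

lemma pass_ne (hL : L.Valid) {e : W × W} {r : ℤ} {w : W} (he : L.Pass e r) (hw : L.row w = r) :
    L.X e r ≠ L.x w := by
  subst hw; exact hL.pass_vertex e w he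

/-- An edge passing through a row meets no other edge in that row. -/
lemma eq_of_pass (hL : L.Valid) {e f : W × W} {r : ℤ} (he : L.Pass e r) (hf : L.Up f)
    (h1 : L.row f.1 ≤ r) (h2 : r ≤ L.row f.2) (h : L.X e r = L.X f r) : e = f := by
  rcases h1.eq_or_lt with h1 | h1
  · exact absurd (h.trans (hL.X_of_fst hf h1)) (hL.pass_ne he h1)
  rcases h2.eq_or_lt with h2 | h2
  · exact absurd (h.trans (hL.X_of_snd hf h2.symm)) (hL.pass_ne he h2.symm)
  exact hL.pass_edge e f r he ⟨hf, h1, h2⟩ h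

lemma mid_lt_of_lt (hL : L.Valid) {e f : W × W} {r : ℤ} (he : L.Spans e r) (hf : L.Spans f r)
    (h : L.X e r < L.X f r) : L.mid e r < L.mid f r := by
  have := hL.cross e f r he hf h
  unfold mid; linarith

lemma mid_lt_of_lt_succ (hL : L.Valid) {e f : W × W} {r : ℤ} (he : L.Spans e r)
    (hf : L.Spans f r) (h : L.X e (r + 1) < L.X f (r + 1)) : L.mid e r < L.mid f r := by
  have : L.X e r ≤ L.X f r := by
    by_contra! hc
    exact absurd (hL.cross f e r hf he hc) (not_le.2 h)
  unfold mid; linarith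

lemma le_of_mid_le (hL : L.Valid) {e f : W × W} {r : ℤ} (he : L.Spans e r) (hf : L.Spans f r)
    (h : L.mid e r ≤ L.mid f r) : L.X e r ≤ L.X f r := by
  by_contra! hc
  exact absurd (hL.mid_lt_of_lt hf he hc) (not_lt.2 h)

lemma succ_le_of_mid_le (hL : L.Valid) {e f : W × W} {r : ℤ} (he : L.Spans e r)
    (hf : L.Spans f r) (h : L.mid e r ≤ L.mid f r) : L.X e (r + 1) ≤ L.X f (r + 1) := by
  by_contra! hc
  exact absurd (hL.mid_lt_of_lt_succ hf he hc) (not_lt.2 h)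

lemma fst_eq_of_X_eq (hL : L.Valid) {e f : W × W} {r : ℤ} (he : L.Spans e r)
    (hf : L.Spans f r) (h : L.X e r = L.X f r) : e.1 = f.1 := by
  obtain ⟨he, he1, he2⟩ := he
  obtain ⟨hf, hf1, hf2⟩ := hf
  rcases he1.eq_or_lt with h1 | h1
  · rcases hf1.eq_or_lt with h2 | h2
    · rw [hL.X_of_fst he h1, hL.X_of_fst hf h2] at h
      exact hL.inj _ _ (h1.trans h2.symm) h
    · rw [hL.eq_of_pass ⟨hf, h2, hf2⟩ he he1 he2.le h.symm]
  · rw [hL.eq_of_pass ⟨he, h1, he2⟩ hf hf1 hf2.le h]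

lemma snd_eq_of_X_eq (hL : L.Valid) {e f : W × W} {r : ℤ} (he : L.Spans e r)
    (hf : L.Spans f r) (h : L.X e (r + 1) = L.X f (r + 1)) : e.2 = f.2 := by
  obtain ⟨he, he1, he2⟩ := he
  obtain ⟨hf, hf1, hf2⟩ := hf
  rcases (Int.add_one_le_of_lt he2).eq_or_lt with h1 | h1
  · rcases (Int.add_one_le_of_lt hf2).eq_or_lt with h2 | h2
    · rw [hL.X_of_snd he h1.symm, hL.X_of_snd hf h2.symm] at h
      exact hL.inj _ _ (h1.symm.trans h2) h
    · rw [hL.eq_of_pass ⟨hf, by omega, h2⟩ he (by omega) he2 h.symm]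
  · rw [hL.eq_of_pass ⟨he, by omega, h1⟩ hf (by omega) hf2 h]

lemma eq_of_mid_eq (hL : L.Valid) {e f : W × W} {r : ℤ} (he : L.Spans e r) (hf : L.Spans f r)
    (h : L.mid e r = L.mid f r) : e = f :=
  Prod.ext
    (hL.fst_eq_of_X_eq he hf ((hL.le_of_mid_le he hf h.le).antisymm (hL.le_of_mid_le hf he h.ge)))
    (hL.snd_eq_of_X_eq he hf
      ((hL.succ_le_of_mid_le he hf h.le).antisymm (hL.succ_le_of_mid_le hf he h.ge)))

lemma mid_lt_succ (hL : L.Valid) {e f : W × W} {r : ℤ} (he : L.Spans e r) (hf : L.Spans f r)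
    (he' : L.Spans e (r + 1)) (hf' : L.Spans f (r + 1)) (h : L.mid e r < L.mid f r) :
    L.X e (r + 1) < L.X f (r + 1) := by
  refine (hL.succ_le_of_mid_le he hf h.le).lt_of_ne fun hc => ?_
  have := hL.eq_of_pass ⟨he.1, by linarith [he.2.1], he'.2.2⟩ hf.1 hf'.2.1 hf'.2.2.le hc
  exact absurd h (this ▸ lt_irrefl _)

lemma mid_lt_of_le (hL : L.Valid) {e f : W × W} {r s : ℤ} (hrs : r ≤ s) (he : L.Spans e r)
    (hf : L.Spans f r) (h : L.mid e r < L.mid f r) :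
    L.Spans e s → L.Spans f s → L.mid e s < L.mid f s := by
  induction s, hrs using Int.leInduction with
  | base => exact fun _ _ => h
  | succ s hs ih =>
    intro he' hf'
    have h1 : L.Spans e s := ⟨he.1, he.2.1.trans hs, by linarith [he'.2.2]⟩
    have h2 : L.Spans f s := ⟨hf.1, hf.2.1.trans hs, by linarith [hf'.2.2]⟩
    exact hL.mid_lt_of_lt he' hf' (hL.mid_lt_succ h1 h2 he' hf' (ih h1 h2))

/-- The left-to-right order of two edges is the same in all strips crossed by both. -/
lemma mid_lt (hL : L.Valid) {e f : W × W} {r s : ℤ} (he : L.Spans e r)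
    (hf : L.Spans f r) (h : L.mid e r < L.mid f r)
    (he' : L.Spans e s) (hf' : L.Spans f s) : L.mid e s < L.mid f s := by
  rcases le_total r s with hrs | hrs
  · exact hL.mid_lt_of_le hrs he hf h he' hf'
  · by_contra! hc
    rcases hc.eq_or_lt with hc | hc
    · rw [hL.eq_of_mid_eq hf' he' hc] at h
      exact lt_irrefl _ h
    · exact lt_asymm h (hL.mid_lt_of_le hrs hf' he' hc hf he)

lemma flipX (hL : L.Valid) : L.flipX.Valid where
  inj u v h1 h2 := hL.inj u v h1 (neg_injective h2)
  X_fst e he := congrArg Neg.neg (hL.X_fst e he)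
  X_snd e he := congrArg Neg.neg (hL.X_snd e he)
  pass_vertex e w h1 h2 := hL.pass_vertex e w h1 (neg_injective h2)
  pass_edge e f r h1 h2 h3 := hL.pass_edge e f r h1 h2 (neg_injective h3)
  cross e f r h1 h2 h3 := neg_le_neg (hL.cross f e r h2 h1 (neg_lt_neg_iff.1 h3))
  horiz_vertex u v w h1 h2 h3 h4 := by
    refine neg_le_neg ?_
    by_contra! hc
    exact absurd (hL.horiz_vertex v u w h1.symm h2.symm (h3.trans h2) hc)
      (not_le.2 (neg_lt_neg_iff.1 h4))
  horiz_edge u v e h1 h2 h3 h4 := by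
    refine neg_le_neg ?_
    by_contra! hc
    change L.row u = L.row v at h2
    change L.Pass e (L.row u) at h3
    change L.x v < L.X e (L.row u) at hc
    have := hL.horiz_edge v u e h1.symm h2.symm (h2 ▸ h3)
    rw [← h2] at this
    exact absurd (this hc) (not_le.2 (neg_lt_neg_iff.1 h4))

lemma flipY (hL : L.Valid) : L.flipY.Valid where
  inj u v h1 h2 := hL.inj u v (neg_injective h1) h2
  X_fst e he := by
    have := hL.X_snd _ (flipY_up.1 he)
    simpa [Layout.flipY] using this
  X_snd e he := by
    have := hL.X_fst _ (flipY_up.1 he)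
    simpa [Layout.flipY] using this
  pass_vertex e w h1 := by
    have := hL.pass_vertex e.swap w (by simpa [Layout.flipY] using flipY_pass.1 h1)
    simpa [Layout.flipY] using this
  pass_edge e f r h1 h2 h3 :=
    Prod.swap_injective (hL.pass_edge _ _ _ (flipY_pass.1 h1) (flipY_pass.1 h2) h3)
  cross e f r h1 h2 h3 := by
    have h1 := flipY_spans.1 h1
    have h2 := flipY_spans.1 h2
    simp only [Layout.flipY] at h3 ⊢
    rw [show -(r + 1) = -r - 1 by ring]
    by_contra! hc
    have := hL.cross _ _ _ h2 h1 hc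
    rw [show -r - 1 + 1 = -r by ring] at this
    linarith
  horiz_vertex u v w h1 h2 h3 h4 :=
    hL.horiz_vertex u v w h1 (neg_injective h2) (neg_injective h3) h4
  horiz_edge u v e h1 h2 h3 h4 := by
    have := hL.horiz_edge u v e.swap h1 (neg_injective h2)
      (by simpa [Layout.flipY] using flipY_pass.1 h3)
    simp only [Layout.flipY, neg_neg] at h4 ⊢
    exact this h4

end Valid

/-- From `u`, one can follow the left side of `e` upwards. -/
def SeesUp (L : Layout W) (u : W) (e : W × W) : Prop :=
  L.Spans e (L.row u) ∧ L.x u ≤ L.X e (L.row u) ∧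
    ∀ g, L.Spans g (L.row u) → L.x u < L.X g (L.row u) → L.mid e (L.row u) ≤ L.mid g (L.row u)

/-- From `v`, one can follow the left side of `e` downwards. -/
def SeesDown (L : Layout W) (v : W) (e : W × W) : Prop :=
  L.Spans e (L.row v - 1) ∧ L.x v ≤ L.X e (L.row v) ∧
    ∀ g, L.Spans g (L.row v - 1) → L.x v < L.X g (L.row v) →
      L.mid e (L.row v - 1) ≤ L.mid g (L.row v - 1)

lemma flipY_seesUp {L : Layout W} {u : W} {e : W × W} :
    L.flipY.SeesUp u e ↔ L.SeesDown u e.swap := by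
  unfold SeesUp SeesDown
  simp only [flipY_spans, flipY_mid]
  simp only [flipY, neg_neg]
  refine and_congr_right fun _ => and_congr_right fun _ => ⟨fun h g => ?_, fun h g => h g.swap⟩
  simpa using h g.swap

lemma flipY_seesDown {L : Layout W} {u : W} {e : W × W} :
    L.flipY.SeesDown u e ↔ L.SeesUp u e.swap := by
  unfold SeesUp SeesDown
  simp only [flipY_spans, flipY_mid]
  simp only [flipY, neg_neg]
  rw [show -(-L.row u - 1) - 1 = L.row u by ring]
  refine and_congr_right fun _ => and_congr_right fun _ => ⟨fun h g => ?_, fun h g => h g.swap⟩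
  simpa using h g.swap

/-- `g` and `f` are consecutive, from left to right, in the strip above row `r`. -/
def Consec (L : Layout W) (g f : W × W) (r : ℤ) : Prop :=
  L.Spans g r ∧ L.Spans f r ∧ L.mid g r < L.mid f r ∧
    ∀ h, L.Spans h r → L.mid g r < L.mid h r → L.mid f r ≤ L.mid h r

lemma Consec.le {L : Layout W} {g f h : W × W} {r : ℤ} (hc : L.Consec g f r) (hh : L.Spans h r)
    (hlt : L.mid h r < L.mid f r) : L.mid h r ≤ L.mid g r := by
  by_contra! hcon
  exact absurd (hc.2.2.2 h hh hcon) (not_le.2 hlt)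

lemma Consec.flipX {L : Layout W} {g f : W × W} {r : ℤ} (hc : L.Consec g f r) :
    L.flipX.Consec f g r := by
  refine ⟨hc.2.1, hc.1, ?_, fun h hh hlt => ?_⟩
  · rw [flipX_mid, flipX_mid]; exact neg_lt_neg hc.2.2.1
  · rw [flipX_mid, flipX_mid] at *; exact neg_le_neg (hc.le hh (neg_lt_neg_iff.1 hlt))

lemma flipY_consec {L : Layout W} {g f : W × W} {r : ℤ} :
    L.flipY.Consec g f r ↔ L.Consec g.swap f.swap (-r - 1) := by
  unfold Consec
  simp only [flipY_spans, flipY_mid]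
  refine and_congr_right fun _ => and_congr_right fun _ => and_congr_right fun _ =>
    ⟨fun h k => ?_, fun h k => h k.swap⟩
  simpa using h k.swap

/-- A valid layout with rows between `lo` and `hi`, in which every missing edge that could be
drawn along the side of another edge, or along a row, is already present. -/
structure Saturated (L : Layout W) (lo hi : ℤ) : Prop extends L.Valid where
  lo_le : ∀ w, lo ≤ L.row w
  le_hi : ∀ w, L.row w ≤ hi
  exists_up_of_lo : ∀ w, L.row w = lo → ∃ v, L.Up (w, v)
  exists_up_of_hi : ∀ w, L.row w = hi → ∃ u, L.Up (u, w)
  exists_right : ∀ w, lo < L.row w → L.row w < hi →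
    ∃ e, L.Pass e (L.row w) ∧ L.x w < L.X e (L.row w)
  exists_left : ∀ w, lo < L.row w → L.row w < hi →
    ∃ e, L.Pass e (L.row w) ∧ L.X e (L.row w) < L.x w
  adj_left : ∀ u v e, L.SeesUp u e → L.SeesDown v e → L.row u < L.row v → L.G.Adj u v
  adj_right : ∀ u v e, L.flipX.SeesUp u e → L.flipX.SeesDown v e → L.row u < L.row v → L.G.Adj u v
  adj_horiz : ∀ u v, L.row u = L.row v → L.x u < L.x v →
    (∀ w, L.row w = L.row u → L.x u < L.x w → L.x v ≤ L.x w) →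
    (∀ e, L.Pass e (L.row u) → L.x u < L.X e (L.row u) → L.x v ≤ L.X e (L.row u)) → L.G.Adj u v

lemma SeesUp.up_of_seesDown {L : Layout W} {lo hi : ℤ} (hS : L.Saturated lo hi) {u v : W}
    {e : W × W} (h1 : L.SeesUp u e) (h2 : L.SeesDown v e) (h : L.row u < L.row v) :
    L.Up (u, v) := ⟨hS.adj_left u v e h1 h2 h, h⟩

namespace Saturated

variable {L : Layout W} {lo hi : ℤ}

lemma flipX (hS : L.Saturated lo hi) : L.flipX.Saturated lo hi where
  toValid := hS.toValid.flipX
  lo_le := hS.lo_le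
  le_hi := hS.le_hi
  exists_up_of_lo := hS.exists_up_of_lo
  exists_up_of_hi := hS.exists_up_of_hi
  exists_right w h1 h2 := by
    obtain ⟨e, he, hx⟩ := hS.exists_left w h1 h2
    exact ⟨e, he, neg_lt_neg hx⟩
  exists_left w h1 h2 := by
    obtain ⟨e, he, hx⟩ := hS.exists_right w h1 h2
    exact ⟨e, he, neg_lt_neg hx⟩
  adj_left := hS.adj_right
  adj_right u v e h1 h2 := by
    have : L.flipX.flipX = L := by simp [Layout.flipX]
    rw [this] at h1 h2
    exact hS.adj_left u v e h1 h2
  adj_horiz u v h1 h2 h3 h4 := by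
    change L.row u = L.row v at h1
    refine (hS.adj_horiz v u h1.symm (neg_lt_neg_iff.1 h2) (fun w hw hlt => ?_)
      fun e he hlt => ?_).symm
    · by_contra! hc
      exact absurd (h3 w (hw.trans h1.symm) (neg_lt_neg hc)) (not_le.2 (neg_lt_neg hlt))
    · by_contra! hc
      rw [← h1] at he hc hlt
      exact absurd (h4 e he (neg_lt_neg hc)) (not_le.2 (neg_lt_neg hlt))

lemma flipY (hS : L.Saturated lo hi) : L.flipY.Saturated (-hi) (-lo) where
  toValid := hS.toValid.flipY
  lo_le w := neg_le_neg (hS.le_hi w)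
  le_hi w := neg_le_neg (hS.lo_le w)
  exists_up_of_lo w hw := by
    obtain ⟨u, hu⟩ := hS.exists_up_of_hi w (neg_injective hw)
    exact ⟨u, flipY_up.2 hu⟩
  exists_up_of_hi w hw := by
    obtain ⟨u, hu⟩ := hS.exists_up_of_lo w (neg_injective hw)
    exact ⟨u, flipY_up.2 hu⟩
  exists_right w h1 h2 := by
    obtain ⟨e, he, hx⟩ := hS.exists_right w (neg_lt_neg_iff.1 h2) (neg_lt_neg_iff.1 h1)
    refine ⟨e.swap, flipY_pass.2 ?_, ?_⟩ <;> simpa [Layout.flipY]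
  exists_left w h1 h2 := by
    obtain ⟨e, he, hx⟩ := hS.exists_left w (neg_lt_neg_iff.1 h2) (neg_lt_neg_iff.1 h1)
    refine ⟨e.swap, flipY_pass.2 ?_, ?_⟩ <;> simpa [Layout.flipY]
  adj_left u v e h1 h2 h3 :=
    (hS.adj_left v u _ (flipY_seesDown.1 h2) (flipY_seesUp.1 h1) (neg_lt_neg_iff.1 h3)).symm
  adj_right u v e h1 h2 h3 :=
    (hS.adj_right v u _ (flipY_seesDown (L := L.flipX).1 h2) (flipY_seesUp (L := L.flipX).1 h1)
      (neg_lt_neg_iff.1 h3)).symm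
  adj_horiz u v h1 h2 h3 h4 := by
    refine hS.adj_horiz u v (neg_injective h1) h2 (fun w hw => h3 w (congrArg Neg.neg hw))
      fun e he => ?_
    have := h4 e.swap (flipY_pass.2 (by simpa [Layout.flipY]))
    simpa [Layout.flipY] using this

lemma seesDown_snd (hS : L.Saturated lo hi) {e : W × W} (he : L.Up e) : L.SeesDown e.2 e := by
  have hsp : L.Spans e (L.row e.2 - 1) := ⟨he, by linarith [he.2, Int.le_sub_one_of_lt he.2], by linarith⟩
  refine ⟨hsp, (hS.X_snd e he).ge, fun g hg hlt => ?_⟩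
  rw [← hS.X_snd e he] at hlt
  exact (hS.mid_lt_of_lt_succ hsp hg (by simpa using hlt)).le

lemma up_of_seesUp (hS : L.Saturated lo hi) {u : W} {e : W × W} (h : L.SeesUp u e) :
    L.Up (u, e.2) :=
  h.up_of_seesDown hS (hS.seesDown_snd h.1.1) h.1.2.2

lemma up_of_seesDown (hS : L.Saturated lo hi) {v : W} {e : W × W} (h : L.SeesDown v e) :
    L.Up (e.1, v) := by
  have : L.flipY.SeesUp v e.swap := flipY_seesUp.2 (by simpa)
  simpa using flipY_up.1 (hS.flipY.up_of_seesUp this)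

variable [Finite W]

lemma exists_min_mid (L : Layout W) {P : W × W → Prop} (r : ℤ) (h : ∃ e, P e) :
    ∃ e, P e ∧ ∀ g, P g → L.mid e r ≤ L.mid g r :=
  Set.exists_min_image {e | P e} (fun e => L.mid e r) (Set.toFinite _) h

/-- Every vertex below the top row has an edge going up. -/
lemma exists_up (hS : L.Saturated lo hi) {w : W} (hw : L.row w < hi) : ∃ v, L.Up (w, v) := by
  rcases (hS.lo_le w).eq_or_lt with h | h
  · exact hS.exists_up_of_lo w h.symm
  obtain ⟨e, he, hx⟩ := hS.exists_right w h hw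
  obtain ⟨f, ⟨hf1, hf2⟩, hf3⟩ := exists_min_mid L
    (P := fun f => L.Spans f (L.row w) ∧ L.x w < L.X f (L.row w)) (L.row w)
    ⟨e, ⟨he.1, he.2.1.le, he.2.2⟩, hx⟩
  exact ⟨f.2, hS.up_of_seesUp ⟨hf1, hf2.le, fun g hg hlt => hf3 g ⟨hg, hlt⟩⟩⟩

/-- Every vertex above the bottom row has an edge going down. -/
lemma exists_down (hS : L.Saturated lo hi) {w : W} (hw : lo < L.row w) : ∃ u, L.Up (u, w) := by
  obtain ⟨u, hu⟩ := hS.flipY.exists_up (w := w) (neg_lt_neg hw)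
  exact ⟨u, flipY_up.1 hu⟩

lemma consec_succ (hS : L.Saturated lo hi) {g f : W × W} {r : ℤ} (hc : L.Consec g f r)
    (hg : L.Spans g (r + 1)) (hf : L.Spans f (r + 1)) : L.Consec g f (r + 1) := by
  obtain ⟨hg0, hf0, hlt, hmin⟩ := id hc
  have hX := hS.mid_lt_succ hg0 hf0 hg hf hlt
  refine ⟨hg, hf, hS.mid_lt_of_lt hg hf hX, fun h hh hgh => ?_⟩
  by_contra! hhf
  rcases lt_or_ge r (L.row h.1) with hr | hr
  · have hrow : L.row h.1 = r + 1 := le_antisymm hh.2.1 hr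
    have hXh := hS.X_of_fst hh.1 hrow
    obtain ⟨u, hu⟩ := hS.exists_down (w := h.1) (by linarith [hS.lo_le g.1, hg0.2.1])
    have hk : L.Spans (u, h.1) r := by
      refine ⟨hu, ?_, by omega⟩
      have := hu.2
      simp only at this ⊢
      omega
    have hXk : L.X (u, h.1) (r + 1) = L.x h.1 := hS.X_of_snd hu hrow
    have h1 := hS.le_of_mid_le hg hh hgh.le
    have h2 := hS.le_of_mid_le hh hf hhf.le
    have h1' : L.X g (r + 1) ≠ L.x h.1 := hS.pass_ne ⟨hg.1, by linarith [hg0.2.1], hg.2.2⟩ hrow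
    have h2' : L.X f (r + 1) ≠ L.x h.1 := hS.pass_ne ⟨hf.1, by linarith [hf0.2.1], hf.2.2⟩ hrow
    rw [hXh] at h1 h2
    have h3 := hS.mid_lt_of_lt_succ hg0 hk (by rw [hXk]; exact h1.lt_of_ne h1')
    have h4 := hS.mid_lt_of_lt_succ hk hf0 (by rw [hXk]; exact h2.lt_of_ne h2'.symm)
    exact absurd (hmin _ hk h3) (not_le.2 h4)
  · have hh0 : L.Spans h r := ⟨hh.1, hr, by linarith [hh.2.2]⟩
    exact absurd (hmin h hh0 (hS.mid_lt hg hh hgh hg0 hh0))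
      (not_le.2 (hS.mid_lt hh hf hhf hh0 hf0))

lemma consec_of_le (hS : L.Saturated lo hi) {g f : W × W} {r s : ℤ} (hrs : r ≤ s)
    (hc : L.Consec g f r) : L.Spans g s → L.Spans f s → L.Consec g f s := by
  induction s, hrs using Int.leInduction with
  | base => exact fun _ _ => hc
  | succ s hs ih =>
    intro hg hf
    exact hS.consec_succ (ih ⟨hg.1, hc.1.2.1.trans hs, by linarith [hg.2.2]⟩
      ⟨hf.1, hc.2.1.2.1.trans hs, by linarith [hf.2.2]⟩) hg hf

/-- Edges that are consecutive in one strip are consecutive in all strips crossed by both. -/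
lemma consec_trans (hS : L.Saturated lo hi) {g f : W × W} {r s : ℤ} (hc : L.Consec g f r)
    (hg : L.Spans g s) (hf : L.Spans f s) : L.Consec g f s := by
  rcases le_total r s with hrs | hrs
  · exact hS.consec_of_le hrs hc hg hf
  · have h1 : L.flipY.Consec g.swap f.swap (-r - 1) := flipY_consec.2 (by simpa using hc)
    have h2 := hS.flipY.consec_of_le (s := -s - 1) (by omega) h1
      (flipY_spans.2 (by simpa using hg)) (flipY_spans.2 (by simpa using hf))
    simpa using flipY_consec.1 h2

/-- The lower end of `g` sees the right neighbour of `g`. -/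
lemma seesUp_of_consec (hS : L.Saturated lo hi) {g f : W × W} {r : ℤ} (hc : L.Consec g f r)
    (h : L.row f.1 ≤ L.row g.1) : L.SeesUp g.1 f := by
  have hg : L.Spans g (L.row g.1) := ⟨hc.1.1, le_rfl, hc.1.1.2⟩
  have hf : L.Spans f (L.row g.1) := ⟨hc.2.1.1, h, hc.1.2.1.trans_lt hc.2.1.2.2⟩
  have hc' := hS.consec_trans hc hg hf
  have hX := hS.X_fst g hg.1
  refine ⟨hf, hX ▸ hS.le_of_mid_le hg hf hc'.2.2.1.le, fun k hk hlt => ?_⟩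
  exact hc'.2.2.2 k hk (hS.mid_lt_of_lt hg hk (hX ▸ hlt))

lemma up_fst_of_consec (hS : L.Saturated lo hi) {g f : W × W} {r : ℤ} (hc : L.Consec g f r)
    (h : L.row f.1 ≤ L.row g.1) : L.Up (g.1, f.2) :=
  hS.up_of_seesUp (hS.seesUp_of_consec hc h)

lemma up_snd_of_consec (hS : L.Saturated lo hi) {g f : W × W} {r : ℤ} (hc : L.Consec g f r)
    (h : L.row g.2 ≤ L.row f.2) : L.Up (f.1, g.2) := by
  have h1 : L.flipY.Consec g.swap f.swap (-r - 1) := flipY_consec.2 (by simpa using hc)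
  exact flipY_up.1 (hS.flipY.up_fst_of_consec h1 (neg_le_neg h))

lemma eq_or_eq_of_cross (hS : L.Saturated lo hi) {g f : W × W} {r : ℤ} (hc : L.Consec g f r)
    (h1 : L.row f.1 ≤ L.row g.1) (h2 : L.row f.2 ≤ L.row g.2) : g.1 = f.1 ∨ g.2 = f.2 := by
  have hk := hS.up_fst_of_consec hc h1
  obtain ⟨hg, hf, hlt, hmin⟩ := id hc
  have hkr : L.Spans (g.1, f.2) r := ⟨hk, hg.2.1, hf.2.2⟩
  rcases le_or_gt (L.mid (g.1, f.2) r) (L.mid g r) with hle | hgt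
  · right
    have hg' : L.Spans g (L.row f.2 - 1) := ⟨hg.1, by linarith [hg.2.1, hf.2.2], by linarith⟩
    have hf' : L.Spans f (L.row f.2 - 1) := ⟨hf.1, by linarith [hf.2.1, hf.2.2], by linarith⟩
    have hk' : L.Spans (g.1, f.2) (L.row f.2 - 1) := ⟨hk, by linarith [hg.2.1, hf.2.2], by simp⟩
    have hc' := hS.consec_trans hc hg' hf'
    rcases hle.eq_or_lt with heq | hlt'
    · rw [← hS.eq_of_mid_eq hkr hg heq]
    have e1 := hS.succ_le_of_mid_le hk' hg' (hS.mid_lt hkr hg hlt' hk' hg').le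
    have e2 := hS.succ_le_of_mid_le hg' hf' hc'.2.2.1.le
    have e3 : L.X (g.1, f.2) (L.row f.2 - 1 + 1) = L.x f.2 := hS.X_of_snd hk (by simp)
    have e4 : L.X f (L.row f.2 - 1 + 1) = L.x f.2 := hS.X_of_snd hf.1 (by simp)
    exact hS.snd_eq_of_X_eq hg' hf' (by linarith)
  · left
    have hle := hmin _ hkr hgt
    have hg' : L.Spans g (L.row g.1) := ⟨hg.1, le_rfl, hg.1.2⟩
    have hf' : L.Spans f (L.row g.1) := ⟨hf.1, h1, hg.2.1.trans_lt hf.2.2⟩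
    have hk' : L.Spans (g.1, f.2) (L.row g.1) := ⟨hk, le_rfl, hk.2⟩
    have hc' := hS.consec_trans hc hg' hf'
    rcases hle.eq_or_lt with heq | hlt'
    · rw [hS.eq_of_mid_eq hf hkr heq]
    have e1 := hS.le_of_mid_le hf' hk' (hS.mid_lt hf hkr hlt' hf' hk').le
    have e2 := hS.le_of_mid_le hg' hf' hc'.2.2.1.le
    have e3 : L.X (g.1, f.2) (L.row g.1) = L.x g.1 := hS.X_of_fst hk rfl
    have e4 : L.X g (L.row g.1) = L.x g.1 := hS.X_of_fst hg.1 rfl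
    exact hS.fst_eq_of_X_eq hg' hf' (by linarith)

lemma false_of_nested (hS : L.Saturated lo hi) {g f : W × W} {r : ℤ} (hc : L.Consec g f r)
    (h1 : L.row f.1 < L.row g.1) (h2 : L.row g.2 < L.row f.2) : False := by
  have hk := hS.up_fst_of_consec hc h1.le
  have hl := hS.up_snd_of_consec hc h2.le
  have hg : ∀ s, L.row g.1 ≤ s → s < L.row g.2 → L.Spans g s := fun s a b => ⟨hc.1.1, a, b⟩
  have hf : ∀ s, L.row g.1 ≤ s → s < L.row g.2 → L.Spans f s :=
    fun s a b => ⟨hc.2.1.1, h1.le.trans a, b.trans h2⟩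
  have hk' : ∀ s, L.row g.1 ≤ s → s < L.row g.2 → L.Spans (g.1, f.2) s :=
    fun s a b => ⟨hk, a, b.trans h2⟩
  have hl' : ∀ s, L.row g.1 ≤ s → s < L.row g.2 → L.Spans (f.1, g.2) s :=
    fun s a b => ⟨hl, h1.le.trans a, b⟩
  have hrow := hc.1.1.2
  set p := L.row g.1 with hp
  set q := L.row g.2 - 1 with hq
  have p1 : p ≤ p := le_rfl
  have p2 : p < L.row g.2 := hrow
  have q1 : p ≤ q := by omega
  have q2 : q < L.row g.2 := by omega
  have hcp := hS.consec_trans hc (hg p p1 p2) (hf p p1 p2)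
  have hcq := hS.consec_trans hc (hg q q1 q2) (hf q q1 q2)
  have xg : L.X g p = L.x g.1 := hS.X_of_fst hc.1.1 rfl
  have xk : L.X (g.1, f.2) p = L.x g.1 := hS.X_of_fst hk rfl
  have yg : L.X g (q + 1) = L.x g.2 := hS.X_of_snd hc.1.1 (by omega)
  have yl : L.X (f.1, g.2) (q + 1) = L.x g.2 := hS.X_of_snd hl (by simp [hq])
  have hfp : L.X f p ≠ L.x g.1 := hS.pass_ne ⟨hc.2.1.1, h1, p2.trans h2⟩ rfl
  have hfq : L.X f (q + 1) ≠ L.x g.2 := hS.pass_ne ⟨hc.2.1.1, by omega, by omega⟩ (by omega)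
  have hlp : L.X (f.1, g.2) p ≠ L.x g.1 := hS.pass_ne ⟨hl, h1, p2⟩ rfl
  have hkq : L.X (g.1, f.2) (q + 1) ≠ L.x g.2 :=
    hS.pass_ne ⟨hk, by simp only; omega, by simp only; omega⟩ (by omega)
  have fp := hS.le_of_mid_le (hg p p1 p2) (hf p p1 p2) hcp.2.2.1.le
  have fq := hS.succ_le_of_mid_le (hg q q1 q2) (hf q q1 q2) hcq.2.2.1.le
  have kp : L.mid (g.1, f.2) p ≤ L.mid g p :=
    hcp.le (hk' p p1 p2) (hS.mid_lt_of_lt (hk' p p1 p2) (hf p p1 p2)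
      (by rw [xk, ← xg]; exact fp.lt_of_ne (xg ▸ hfp.symm)))
  have lq : L.mid (f.1, g.2) q ≤ L.mid g q :=
    hcq.le (hl' q q1 q2) (hS.mid_lt_of_lt_succ (hl' q q1 q2) (hf q q1 q2)
      (by rw [yl, ← yg]; exact fq.lt_of_ne (yg ▸ hfq.symm)))
  have kne : L.mid (g.1, f.2) p ≠ L.mid g p := fun h => by
    have := hS.eq_of_mid_eq (hk' p p1 p2) (hg p p1 p2) h
    have := congrArg (fun e : W × W => L.row e.2) this
    simp only at this
    omega
  have lne : L.mid (f.1, g.2) q ≠ L.mid g q := fun h => by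
    have := hS.eq_of_mid_eq (hl' q q1 q2) (hg q q1 q2) h
    have := congrArg (fun e : W × W => L.row e.1) this
    simp only at this
    omega
  have lp := hS.mid_lt (hl' q q1 q2) (hg q q1 q2) (lq.lt_of_ne lne) (hl' p p1 p2) (hg p p1 p2)
  have kq := hS.mid_lt (hk' p p1 p2) (hg p p1 p2) (kp.lt_of_ne kne) (hk' q q1 q2) (hg q q1 q2)
  have e1 := hS.le_of_mid_le (hl' p p1 p2) (hg p p1 p2) lp.le
  have e2 := hS.succ_le_of_mid_le (hk' q q1 q2) (hg q q1 q2) kq.le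
  have a1 := hS.mid_lt_of_lt (hl' p p1 p2) (hk' p p1 p2)
    (by rw [xk]; exact (e1.trans_eq xg).lt_of_ne hlp)
  have a2 := hS.mid_lt_of_lt_succ (hk' q q1 q2) (hl' q q1 q2)
    (by rw [yl]; exact (e2.trans_eq yg).lt_of_ne hkq)
  exact lt_asymm a2 (hS.mid_lt (hl' p p1 p2) (hk' p p1 p2) a1 (hl' q q1 q2) (hk' q q1 q2))

/-- Consecutive edges of a strip have a common end. -/
lemma eq_or_eq_of_consec (hS : L.Saturated lo hi) {g f : W × W} {r : ℤ}
    (hc : L.Consec g f r) : g.1 = f.1 ∨ g.2 = f.2 := by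
  rcases le_or_gt (L.row f.1) (L.row g.1) with h1 | h1
  · rcases le_or_gt (L.row f.2) (L.row g.2) with h2 | h2
    · exact hS.eq_or_eq_of_cross hc h1 h2
    · rcases h1.eq_or_lt with h1 | h1
      · exact (hS.flipX.eq_or_eq_of_cross hc.flipX h1.ge h2.le).imp Eq.symm Eq.symm
      · exact (hS.false_of_nested hc h1 h2).elim
  · rcases le_or_gt (L.row g.2) (L.row f.2) with h2 | h2
    · exact (hS.flipX.eq_or_eq_of_cross hc.flipX h1.le h2).imp Eq.symm Eq.symm
    · exact (hS.flipX.false_of_nested hc.flipX h1 h2).elim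

end Saturated

end Layout

lemma exists_lt_forall_lt {s : Set ℝ} (hs : s.Finite) (c : ℝ) :
    ∃ y < c, ∀ a ∈ s, a < c → a < y := by
  have h : ∀ᶠ y in nhdsWithin c (Iio c), ∀ a ∈ s, a < c → a < y := by
    rw [Filter.eventually_all_finite hs]
    intro a _
    by_cases hac : a < c
    · filter_upwards [Ioo_mem_nhdsLT hac] with y hy _ using hy.1
    · exact Filter.Eventually.of_forall fun y h => absurd h hac
  obtain ⟨y, hy, hyc⟩ := (h.and self_mem_nhdsWithin).exists
  exact ⟨y, hyc, hy⟩

namespace Layout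

variable {W : Type}

lemma sup_edge_adj {G : SimpleGraph W} {u v a b : W} (huv : u ≠ v) :
    (G ⊔ SimpleGraph.edge u v).Adj a b ↔
      G.Adj a b ∨ (a = u ∧ b = v) ∨ (a = v ∧ b = u) := by
  rw [SimpleGraph.sup_adj, SimpleGraph.edge_adj]
  constructor
  · rintro (h | ⟨h, -⟩)
    · exact Or.inl h
    · exact Or.inr h
  · rintro (h | ⟨rfl, rfl⟩ | ⟨rfl, rfl⟩)
    · exact Or.inl h
    · exact Or.inr ⟨Or.inl ⟨rfl, rfl⟩, huv⟩
    · exact Or.inr ⟨Or.inr ⟨rfl, rfl⟩, huv.symm⟩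

/-- A new edge can be drawn along the left side of an existing one. -/
lemma Valid.exists_insert [Finite W] {L : Layout W} (hL : L.Valid) {u v : W} {e : W × W}
    (hu : L.SeesUp u e) (hv : L.SeesDown v e) (huv : L.row u < L.row v) :
    ∃ X : W × W → ℤ → ℝ, (∀ f, f ≠ (u, v) → X f = L.X f) ∧
      (Layout.mk L.row L.x (L.G ⊔ SimpleGraph.edge u v) X).Valid := by
  classical
  have hne : u ≠ v := fun h => huv.ne (congrArg L.row h)
  have hY : ∀ r, ∃ y < L.X e r, (∀ w, L.x w < L.X e r → L.x w < y) ∧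
      ∀ g, L.X g r < L.X e r → L.X g r < y := by
    intro r
    obtain ⟨y, hy, h⟩ := exists_lt_forall_lt
      ((Set.finite_range L.x).union (Set.finite_range fun g => L.X g r)) (L.X e r)
    exact ⟨y, hy, fun w => h _ (Or.inl ⟨w, rfl⟩), fun g => h _ (Or.inr ⟨g, rfl⟩)⟩
  choose Y hYe hYw hYg using hY
  obtain ⟨hesp, hux, hug⟩ := hu
  obtain ⟨hesp', hvx, hvg⟩ := hv
  have he := hesp.1
  set Z : ℤ → ℝ := fun r => if r = L.row u then L.x u else if r = L.row v then L.x v else Y r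
    with hZ
  have Zu : Z (L.row u) = L.x u := by simp [hZ]
  have Zv : Z (L.row v) = L.x v := by simp [hZ, huv.ne']
  have Zr : ∀ r, L.row u < r → r < L.row v → Z r = Y r := fun r h1 h2 => by
    simp [hZ, h1.ne', h2.ne]
  have epass : ∀ r, L.row u < r → r < L.row v → L.Pass e r := fun r h1 h2 =>
    ⟨he, hesp.2.1.trans_lt h1, by have := hesp'.2.2; omega⟩
  have espan : ∀ r, L.row u ≤ r → r < L.row v → L.Spans e r := fun r h1 h2 =>
    ⟨he, hesp.2.1.trans h1, by have := hesp'.2.2; omega⟩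
  have hmid : ∀ g r, L.Spans g r → L.row u < r → r < L.row v →
      (L.X g r ≤ L.X e r → g ≠ e → L.X g r ≤ Z r) ∧ (L.X e r ≤ L.X g r → Z r ≤ L.X g r) := by
    intro g r hg h1 h2
    rw [Zr r h1 h2]
    refine ⟨fun h hge => (hYg r g (h.lt_of_ne fun hc => hge ?_)).le, fun h => (hYe r).le.trans h⟩
    exact (hL.eq_of_pass (epass r h1 h2) hg.1 hg.2.1 hg.2.2.le hc.symm).symm
  have hmid' : ∀ g r, L.Spans g r → L.row u < r + 1 → r + 1 < L.row v →
      (L.X g (r + 1) ≤ L.X e (r + 1) → g ≠ e → L.X g (r + 1) ≤ Z (r + 1)) ∧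
      (L.X e (r + 1) ≤ L.X g (r + 1) → Z (r + 1) ≤ L.X g (r + 1)) := by
    intro g r hg h1 h2
    rw [Zr _ h1 h2]
    refine ⟨fun h hge => (hYg _ g (h.lt_of_ne fun hc => hge ?_)).le,
      fun h => (hYe _).le.trans h⟩
    exact (hL.eq_of_pass (epass _ h1 h2) hg.1 (by linarith [hg.2.1]) hg.2.2 hc.symm).symm
  have key : ∀ g r, L.Spans g r → L.row u ≤ r → r < L.row v →
      (L.mid g r < L.mid e r → L.X g r ≤ Z r ∧ L.X g (r + 1) ≤ Z (r + 1)) ∧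
      (L.mid e r ≤ L.mid g r → Z r ≤ L.X g r ∧ Z (r + 1) ≤ L.X g (r + 1)) := by
    intro g r hg h1 h2
    have her := espan r h1 h2
    refine ⟨fun hlt => ⟨?_, ?_⟩, fun hle => ⟨?_, ?_⟩⟩
    · rcases h1.eq_or_lt with rfl | h1
      · rw [Zu]; by_contra! hc; exact absurd (hug g hg hc) (not_le.2 hlt)
      · exact (hmid g r hg h1 h2).1 (hL.le_of_mid_le hg her hlt.le) fun hc => hlt.ne (hc ▸ rfl)
    · rcases (Int.add_one_le_of_lt h2).eq_or_lt with h2 | h2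
      · have hr : r = L.row v - 1 := by omega
        subst hr
        rw [sub_add_cancel, Zv]; by_contra! hc; exact absurd (hvg g hg hc) (not_le.2 hlt)
      · exact (hmid' g r hg (by omega) h2).1 (hL.succ_le_of_mid_le hg her hlt.le)
          fun hc => hlt.ne (hc ▸ rfl)
    · have := hL.le_of_mid_le her hg hle
      rcases h1.eq_or_lt with rfl | h1
      · rw [Zu]; exact hux.trans this
      · exact (hmid g r hg h1 h2).2 this
    · have := hL.succ_le_of_mid_le her hg hle
      rcases (Int.add_one_le_of_lt h2).eq_or_lt with h2 | h2
      · rw [h2] at this ⊢; rw [Zv]; exact hvx.trans this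
      · exact (hmid' g r hg (by omega) h2).2 this
  refine ⟨fun f => if f = (u, v) then Z else L.X f, fun f hf => if_neg hf, ?_⟩
  set L' : Layout W := ⟨L.row, L.x, L.G ⊔ SimpleGraph.edge u v,
    fun f => if f = (u, v) then Z else L.X f⟩ with hL'
  have hX : ∀ f, f ≠ (u, v) → L'.X f = L.X f := fun f hf => if_neg hf
  have hXn : L'.X (u, v) = Z := if_pos rfl
  have hup : ∀ f, f ≠ (u, v) → L'.Up f → L.Up f := by
    rintro ⟨a, b⟩ hf ⟨h1, h2⟩
    refine ⟨?_, h2⟩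
    change L.row a < L.row b at h2
    rcases (sup_edge_adj hne).1 h1 with h | ⟨rfl, rfl⟩ | ⟨rfl, rfl⟩
    · exact h
    · exact absurd rfl hf
    · exact absurd h2 huv.not_gt
  have hadj : ∀ a b, L'.G.Adj a b → L.row a = L.row b → L.G.Adj a b := by
    intro a b h hab
    rcases (sup_edge_adj hne).1 h with h | ⟨rfl, rfl⟩ | ⟨rfl, rfl⟩
    · exact h
    · exact absurd hab huv.ne
    · exact absurd hab huv.ne'
  refine ⟨hL.inj, ?_, ?_, ?_, ?_, ?_, ?_, ?_⟩
  · intro f hf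
    by_cases h : f = (u, v)
    · subst h; exact (congrFun hXn _).trans Zu
    · rw [hX f h]; exact hL.X_fst f (hup f h hf)
  · intro f hf
    by_cases h : f = (u, v)
    · subst h; exact (congrFun hXn _).trans Zv
    · rw [hX f h]; exact hL.X_snd f (hup f h hf)
  · intro f w hf
    by_cases h : f = (u, v)
    · subst h
      rw [hXn]
      obtain ⟨-, h1, h2⟩ := hf
      change L.row u < L.row w at h1
      change L.row w < L.row v at h2
      change Z (L.row w) ≠ L.x w
      rw [Zr _ h1 h2]
      rcases lt_or_ge (L.x w) (L.X e (L.row w)) with hlt | hge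
      · exact (hYw _ w hlt).ne'
      · exact ((hYe _).trans_le hge).ne
    · rw [hX f h]; exact hL.pass_vertex f w ⟨hup f h hf.1, hf.2⟩
  · have aux : ∀ f r, f ≠ (u, v) → L'.Pass f r → L'.Pass (u, v) r → L'.X (u, v) r ≠ L.X f r := by
      rintro f r hf hfr ⟨-, h1, h2⟩
      rw [hXn, Zr r h1 h2]
      have hf' : L.Pass f r := ⟨hup f hf hfr.1, hfr.2⟩
      rcases lt_or_ge (L.X f r) (L.X e r) with hlt | hge
      · exact (hYg _ f hlt).ne'
      · exact ((hYe _).trans_le hge).ne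
    intro f g r hf hg hfg
    by_cases h : f = (u, v)
    · by_cases h' : g = (u, v)
      · rw [h, h']
      · subst h; rw [hX g h'] at hfg
        exact absurd hfg (aux g r h' hg hf)
    · by_cases h' : g = (u, v)
      · subst h'; rw [hX f h] at hfg
        exact absurd hfg.symm (aux f r h hf hg)
      · rw [hX f h, hX g h'] at hfg
        exact hL.pass_edge f g r ⟨hup f h hf.1, hf.2⟩ ⟨hup g h' hg.1, hg.2⟩ hfg
  · intro f g r hf hg hfg
    by_cases h : f = (u, v)
    · by_cases h' : g = (u, v)
      · rw [h, h'] at hfg; exact absurd hfg (lt_irrefl _)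
      · subst h; rw [hX g h', hXn] at hfg ⊢
        obtain ⟨k1, k2⟩ := key g r ⟨hup g h' hg.1, hg.2⟩ hf.2.1 hf.2.2
        rcases lt_or_ge (L.mid g r) (L.mid e r) with hlt | hge
        · exact absurd (k1 hlt).1 (not_le.2 hfg)
        · exact (k2 hge).2
    · by_cases h' : g = (u, v)
      · subst h'; rw [hX f h, hXn] at hfg ⊢
        obtain ⟨k1, k2⟩ := key f r ⟨hup f h hf.1, hf.2⟩ hg.2.1 hg.2.2
        rcases lt_or_ge (L.mid f r) (L.mid e r) with hlt | hge
        · exact (k1 hlt).2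
        · exact absurd (k2 hge).1 (not_le.2 hfg)
      · rw [hX f h, hX g h'] at *
        exact hL.cross f g r ⟨hup f h hf.1, hf.2⟩ ⟨hup g h' hg.1, hg.2⟩ hfg
  · intro a b w hab h1 h2
    exact hL.horiz_vertex a b w (hadj a b hab h1) h1 h2
  · intro a b f hab h1 hf
    by_cases h : f = (u, v)
    · subst h
      rw [hXn]
      obtain ⟨-, hr1, hr2⟩ := hf
      change L.row u < L.row a at hr1
      change L.row a < L.row v at hr2
      change L.x a < Z (L.row a) → L.x b ≤ Z (L.row a)
      change L.row a = L.row b at h1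
      rw [Zr _ hr1 hr2]
      intro hlt
      by_contra! hc
      have hb := hL.pass_ne (epass _ hr1 hr2) h1.symm
      have : L.X e (L.row a) < L.x b := by
        refine lt_of_le_of_ne ?_ hb
        by_contra! hb'
        exact absurd (hYw _ b hb') hc.not_gt
      exact absurd (hL.horiz_edge a b e (hadj a b hab h1) h1 (epass _ hr1 hr2)
        (hlt.trans (hYe _))) (not_le.2 this)
    · rw [hX f h]
      exact hL.horiz_edge a b f (hadj a b hab h1) h1 ⟨hup f h hf.1, hf.2⟩

/-- A new edge can be drawn between two vertices that are neighbours in their row. -/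
lemma Valid.insert_horiz {L : Layout W} (hL : L.Valid) {u v : W} (huv : L.row u = L.row v)
    (hlt : L.x u < L.x v) (h1 : ∀ w, L.row w = L.row u → L.x u < L.x w → L.x v ≤ L.x w)
    (h2 : ∀ e, L.Pass e (L.row u) → L.x u < L.X e (L.row u) → L.x v ≤ L.X e (L.row u)) :
    (Layout.mk L.row L.x (L.G ⊔ SimpleGraph.edge u v) L.X).Valid := by
  have hne : u ≠ v := fun h => hlt.ne (congrArg L.x h)
  set L' : Layout W := ⟨L.row, L.x, L.G ⊔ SimpleGraph.edge u v, L.X⟩ with hL'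
  have hup : ∀ f, L'.Up f → L.Up f := by
    rintro ⟨a, b⟩ ⟨k1, k2⟩
    refine ⟨?_, k2⟩
    change L.row a < L.row b at k2
    rcases (sup_edge_adj hne).1 k1 with h | ⟨rfl, rfl⟩ | ⟨rfl, rfl⟩
    · exact h
    · exact absurd huv k2.ne
    · exact absurd huv k2.ne'
  refine ⟨hL.inj, fun f hf => hL.X_fst f (hup f hf), fun f hf => hL.X_snd f (hup f hf),
    fun f w hf => hL.pass_vertex f w ⟨hup f hf.1, hf.2⟩,
    fun f g r hf hg => hL.pass_edge f g r ⟨hup f hf.1, hf.2⟩ ⟨hup g hg.1, hg.2⟩,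
    fun f g r hf hg => hL.cross f g r ⟨hup f hf.1, hf.2⟩ ⟨hup g hg.1, hg.2⟩, ?_, ?_⟩
  · intro a b w hab hr hw hxw
    rcases (sup_edge_adj hne).1 hab with h | ⟨rfl, rfl⟩ | ⟨rfl, rfl⟩
    · exact hL.horiz_vertex a b w h hr hw hxw
    · exact h1 w hw hxw
    · exact (hlt.trans hxw).le
  · intro a b f hab hr hf hxf
    have hf' : L.Pass f (L.row a) := ⟨hup f hf.1, hf.2⟩
    rcases (sup_edge_adj hne).1 hab with h | ⟨rfl, rfl⟩ | ⟨rfl, rfl⟩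
    · exact hL.horiz_edge a b f h hr hf' hxf
    · exact h2 f hf' hxf
    · exact (hlt.trans hxf).le

/-- A saturated layout whose bottom row holds `a` and `b` and whose top row holds `c`. -/
structure Framed (L : Layout W) (lo hi : ℤ) (a b c : W) : Prop extends L.Saturated lo hi where
  row_fst : L.row a = lo
  row_snd : L.row b = lo
  row_top : L.row c = hi
  eq_of_row_lo : ∀ w, L.row w = lo → w = a ∨ w = b
  eq_of_row_hi : ∀ w, L.row w = hi → w = c
  x_lt : L.x a < L.x b
  up_fst : L.Up (a, c)
  up_snd : L.Up (b, c)

/-- Pairs of consecutive edges with the same upper end. -/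
def Twins (L : Layout W) : Set ((W × W) × (W × W)) :=
  {p | L.Consec p.1 p.2 (L.row p.2.2 - 1) ∧ p.1.2 = p.2.2}

/-- Horizontal edges, directed to the right. -/
def Horiz (L : Layout W) : Set (W × W) :=
  {p | L.G.Adj p.1 p.2 ∧ L.row p.1 = L.row p.2 ∧ L.x p.1 < L.x p.2}

lemma exists_max_mid [Finite W] (L : Layout W) {P : W × W → Prop} (r : ℤ) (h : ∃ e, P e) :
    ∃ e, P e ∧ ∀ g, P g → L.mid g r ≤ L.mid e r :=
  Set.exists_max_image {e | P e} (fun e => L.mid e r) (Set.toFinite _) h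

lemma ncard_ne_ne [Fintype W] {a b : W} (hab : a ≠ b) :
    {w : W | w ≠ a ∧ w ≠ b}.ncard + 2 = Fintype.card W := by
  have h := Set.ncard_add_ncard_compl ({a, b} : Set W)
  rw [Set.ncard_pair hab, Nat.card_eq_fintype_card] at h
  rw [← h, add_comm]
  congr 2
  ext w
  simp

namespace Framed

variable {L : Layout W} {lo hi : ℤ} {a b c : W}

lemma ne (hF : L.Framed lo hi a b c) : a ≠ b := fun h => hF.x_lt.ne (congrArg L.x h)

lemma lo_lt_hi (hF : L.Framed lo hi a b c) : lo < hi := by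
  have := hF.up_fst.2
  rwa [hF.row_fst, hF.row_top] at this

lemma ne_top (hF : L.Framed lo hi a b c) : b ≠ c := by
  rintro rfl
  exact hF.lo_lt_hi.ne (hF.row_snd.symm.trans hF.row_top)

lemma flipX [Finite W] (hF : L.Framed lo hi a b c) : L.flipX.Framed lo hi b a c where
  toSaturated := hF.toSaturated.flipX
  row_fst := hF.row_snd
  row_snd := hF.row_fst
  row_top := hF.row_top
  eq_of_row_lo w h := (hF.eq_of_row_lo w h).symm
  eq_of_row_hi := hF.eq_of_row_hi
  x_lt := neg_lt_neg hF.x_lt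
  up_fst := hF.up_snd
  up_snd := hF.up_fst

lemma lt_hi (hF : L.Framed lo hi a b c) {w : W} (h : w ≠ c) : L.row w < hi :=
  lt_of_le_of_ne (hF.le_hi w) fun hc => h (hF.eq_of_row_hi w hc)

lemma spans_pred {e : W × W} (he : L.Up e) : L.Spans e (L.row e.2 - 1) :=
  ⟨he, by have := he.2; omega, by omega⟩

lemma spans_fst {e : W × W} (he : L.Up e) : L.Spans e (L.row e.1) := ⟨he, le_rfl, he.2⟩

lemma ncard_up [Fintype W] (hF : L.Framed lo hi a b c) :
    {e | L.Up e}.ncard + 2 = L.Twins.ncard + Fintype.card W := by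
  have hinj : InjOn Prod.snd L.Twins := by
    rintro ⟨g, f⟩ ⟨h1, h2⟩ ⟨g', f'⟩ ⟨h1', h2'⟩ (rfl : f = f')
    have := hF.eq_of_mid_eq h1.1 h1'.1 (le_antisymm (h1'.le h1.1 h1.2.2.1) (h1.le h1'.1 h1'.2.2.1))
    exact Prod.ext this rfl
  have hsub : Prod.snd '' L.Twins ⊆ {e | L.Up e} := by
    rintro _ ⟨p, hp, rfl⟩
    exact hp.1.2.1.1
  have hlt : ∀ e f : W × W, L.Up e → L.Up f → e.2 = f.2 →
      L.mid e (L.row f.2 - 1) < L.mid f (L.row f.2 - 1) → f ∈ Prod.snd '' L.Twins := by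
    intro e f he hf hef hlt
    have hsf := spans_pred hf
    have hse : L.Spans e (L.row f.2 - 1) := hef ▸ spans_pred he
    obtain ⟨g, ⟨hg, hgf⟩, hmax⟩ := exists_max_mid L
      (P := fun g => L.Spans g (L.row f.2 - 1) ∧ L.mid g (L.row f.2 - 1) < L.mid f (L.row f.2 - 1))
      (L.row f.2 - 1) ⟨e, hse, hlt⟩
    refine ⟨(g, f), ⟨⟨hg, hsf, hgf, fun h hh hgh => ?_⟩, ?_⟩, rfl⟩
    · by_contra! hc
      exact absurd (hmax h ⟨hh, hc⟩) (not_le.2 hgh)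
    · have h1 := hF.succ_le_of_mid_le hse hg (hmax e ⟨hse, hlt⟩)
      have h2 := hF.succ_le_of_mid_le hg hsf hgf.le
      have h3 : L.X e (L.row f.2 - 1 + 1) = L.X f (L.row f.2 - 1 + 1) := by
        rw [sub_add_cancel, hF.X_of_snd hf rfl, hF.X_of_snd he (by rw [hef]), hef]
      have h4 : L.X g (L.row f.2 - 1 + 1) = L.X f (L.row f.2 - 1 + 1) :=
        le_antisymm h2 (h3 ▸ h1)
      exact hF.snd_eq_of_X_eq hg hsf h4
  have hdiff : ({e | L.Up e} \ Prod.snd '' L.Twins).ncard = {w | w ≠ a ∧ w ≠ b}.ncard := by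
    refine Set.ncard_congr (fun e _ => e.2) ?_ ?_ ?_
    · rintro e ⟨he, -⟩
      have h1 : lo < L.row e.2 := (hF.lo_le e.1).trans_lt he.2
      constructor
      · intro h; rw [h, hF.row_fst] at h1; exact lt_irrefl _ h1
      · intro h; rw [h, hF.row_snd] at h1; exact lt_irrefl _ h1
    · rintro e f ⟨he, hen⟩ ⟨hf, hfn⟩ h
      have hse : L.Spans e (L.row f.2 - 1) := h ▸ spans_pred he
      refine hF.eq_of_mid_eq hse (spans_pred hf) (le_antisymm ?_ ?_)
      · by_contra! hc
        exact hen (hlt f e hf he h.symm (by rw [h]; exact hc))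
      · by_contra! hc
        exact hfn (hlt e f he hf h hc)
    · rintro w ⟨hwa, hwb⟩
      have hw : lo < L.row w := lt_of_le_of_ne (hF.lo_le w) fun hc =>
        (hF.eq_of_row_lo w hc.symm).elim hwa hwb
      obtain ⟨u, hu⟩ := hF.exists_down hw
      obtain ⟨e, ⟨he, hew⟩, hmin⟩ := Saturated.exists_min_mid L
        (P := fun e => L.Up e ∧ e.2 = w) (L.row w - 1) ⟨(u, w), hu, rfl⟩
      refine ⟨e, ⟨he, ?_⟩, hew⟩
      rintro ⟨⟨g, f⟩, ⟨h1, h2⟩, rfl⟩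
      have := hmin g ⟨h1.1.1, h2.trans hew⟩
      dsimp only at hew
      rw [← hew] at this
      exact absurd this (not_le.2 h1.2.2.1)
  have h1 := Set.ncard_sdiff_add_ncard_of_subset hsub (Set.toFinite _)
  rw [hdiff, hinj.ncard_image] at h1
  have h2 := ncard_ne_ne hF.ne
  omega

lemma consec_fst [Finite W] (hF : L.Framed lo hi a b c) {g f : W × W} (h : (g, f) ∈ L.Twins)
    (hr : L.row f.1 ≤ L.row g.1) : L.Consec g f (L.row g.1) := by
  refine hF.consec_trans h.1 (spans_fst h.1.1.1) ⟨h.1.2.1.1, hr, ?_⟩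
  have := h.1.1.1.2
  have h2 := h.2
  dsimp only at h2
  rwa [h2] at this

lemma twins_fst_ne {g f : W × W} (h : (g, f) ∈ L.Twins) :
    g.1 ≠ f.1 := fun he => by
  have : g = f := Prod.ext he h.2
  exact absurd (h.1.2.2.1) (by rw [this]; exact lt_irrefl _)

lemma injOn_right [Finite W] (hF : L.Framed lo hi a b c) :
    InjOn (fun p : (W × W) × (W × W) => p.1.1) {p ∈ L.Twins | L.row p.2.1 ≤ L.row p.1.1} := by
  have aux : ∀ g f g' : W × W, (g, f) ∈ L.Twins → L.row f.1 ≤ L.row g.1 → L.Up g' →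
      g.1 = g'.1 → L.mid g' (L.row g.1) ≤ L.mid g (L.row g.1) := by
    intro g f g' h hr hg' he
    have hc := hF.consec_fst h hr
    have hsg' : L.Spans g' (L.row g.1) := he ▸ spans_fst hg'
    by_contra! hcon
    have h1 := hF.le_of_mid_le hc.1 hc.2.1 hc.2.2.1.le
    have h2 := hF.le_of_mid_le hc.2.1 hsg' (hc.2.2.2 g' hsg' hcon)
    rw [hF.X_of_fst hg' (by rw [he]), ← he, ← hF.X_of_fst hc.1.1 rfl] at h2
    have h3 := le_antisymm h1 h2
    have h4 := hF.fst_eq_of_X_eq hc.1 hc.2.1 h3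
    exact twins_fst_ne h (by simpa using h4)
  rintro ⟨g, f⟩ ⟨h, hr⟩ ⟨g', f'⟩ ⟨h', hr'⟩ (he : g.1 = g'.1)
  have hc := hF.consec_fst h hr
  have hc' := hF.consec_fst h' hr'
  have h1 := aux g f g' h hr h'.1.1.1 he
  have h2 := aux g' f' g h' hr' h.1.1.1 he.symm
  rw [← he] at h2 hc'
  obtain rfl : g = g' := hF.eq_of_mid_eq hc.1 hc'.1 (le_antisymm h2 h1)
  have := hF.eq_of_mid_eq hc.2.1 hc'.2.1
    (le_antisymm (hc.2.2.2 _ hc'.2.1 hc'.2.2.1) (hc'.2.2.2 _ hc.2.1 hc.2.2.1))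
  rw [this]

lemma exists_right_twin [Finite W] (hF : L.Framed lo hi a b c) {w : W} (hb : w ≠ b) (hc : w ≠ c) :
    ∃ p ∈ L.Twins, L.row p.2.1 ≤ L.row p.1.1 ∧ p.1.1 = w := by
  have hw := hF.lt_hi hc
  obtain ⟨v, hv⟩ := hF.exists_up hw
  obtain ⟨g, ⟨hg, rfl⟩, hmax⟩ := exists_max_mid L
    (P := fun e => L.Up e ∧ e.1 = w) (L.row w) ⟨(w, v), hv, rfl⟩
  have hsg := spans_fst hg
  have hex : ∃ e, L.Spans e (L.row g.1) ∧ L.mid g (L.row g.1) < L.mid e (L.row g.1) := by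
    rcases (hF.lo_le g.1).eq_or_lt with h | h
    · have ha : g.1 = a := (hF.eq_of_row_lo _ h.symm).resolve_right hb
      have hsp : L.Spans (b, c) (L.row g.1) :=
        ⟨hF.up_snd, by rw [← h]; exact hF.row_snd.le, hw.trans_eq hF.row_top.symm⟩
      refine ⟨(b, c), hsp, hF.mid_lt_of_lt hsg hsp ?_⟩
      rw [hF.X_of_fst hg rfl, hF.X_of_fst hF.up_snd (hF.row_snd.trans h), ha]
      exact hF.x_lt
    · obtain ⟨e, he, hx⟩ := hF.exists_right g.1 h hw
      have hsp : L.Spans e (L.row g.1) := ⟨he.1, he.2.1.le, he.2.2⟩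
      exact ⟨e, hsp, hF.mid_lt_of_lt hsg hsp (by rwa [hF.X_of_fst hg rfl])⟩
  obtain ⟨f, ⟨hf, hgf⟩, hmin⟩ := Saturated.exists_min_mid L (L.row g.1) hex
  have hcon : L.Consec g f (L.row g.1) := ⟨hsg, hf, hgf, fun h h1 h2 => hmin h ⟨h1, h2⟩⟩
  have h2 : g.2 = f.2 := (hF.eq_or_eq_of_consec hcon).resolve_left fun h =>
    absurd (hmax f ⟨hf.1, h.symm⟩) (not_le.2 hgf)
  exact ⟨(g, f), ⟨hF.consec_trans hcon (h2 ▸ spans_pred hg) (spans_pred hf.1), h2⟩, hf.2.1, rfl⟩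

lemma ncard_right [Fintype W] (hF : L.Framed lo hi a b c) :
    {p ∈ L.Twins | L.row p.2.1 ≤ L.row p.1.1}.ncard + 2 = Fintype.card W := by
  rw [← ncard_ne_ne hF.ne_top]
  congr 1
  refine Set.ncard_congr (fun p _ => p.1.1) ?_ (fun p q hp hq h => hF.injOn_right hp hq h) ?_
  · rintro ⟨g, f⟩ ⟨h, hr⟩
    dsimp only at hr ⊢
    have hc := hF.consec_fst h hr
    refine ⟨fun hb => ?_, fun hc' => ?_⟩
    · rw [hb, hF.row_snd] at hc
      have hf : L.row f.1 = lo := le_antisymm (by rw [← hF.row_snd, ← hb]; exact hr) (hF.lo_le _)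
      have h1 := hF.le_of_mid_le hc.1 hc.2.1 hc.2.2.1.le
      rw [hF.X_of_fst hc.1.1 (by rw [hb, hF.row_snd]), hF.X_of_fst hc.2.1.1 hf, hb] at h1
      rcases hF.eq_of_row_lo _ hf with h2 | h2
      · rw [h2] at h1; exact absurd h1 hF.x_lt.not_ge
      · exact twins_fst_ne h (hb.trans h2.symm)
    · have := hc.1.1.2.trans_le (hF.le_hi _)
      rw [hc', hF.row_top] at this
      exact lt_irrefl _ this
  · rintro w ⟨hb, hc⟩
    obtain ⟨p, hp, hr, rfl⟩ := hF.exists_right_twin hb hc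
    exact ⟨p, ⟨hp, hr⟩, rfl⟩

lemma ncard_left [Fintype W] (hF : L.Framed lo hi a b c) :
    {p ∈ L.Twins | L.row p.1.1 ≤ L.row p.2.1}.ncard + 2 = Fintype.card W := by
  rw [← hF.flipX.ncard_right]
  congr 1
  refine Set.ncard_congr (fun p _ => p.swap) ?_ (fun p q _ _ h => Prod.swap_injective h) ?_
  · rintro ⟨g, f⟩ ⟨⟨h, h'⟩, hr⟩
    refine ⟨⟨?_, h'.symm⟩, hr⟩
    dsimp only at h' h
    change L.flipX.Consec f g (L.row g.2 - 1)
    rw [h']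
    exact h.flipX
  · rintro ⟨f, g⟩ ⟨⟨h, h'⟩, hr⟩
    refine ⟨(g, f), ⟨⟨?_, h'.symm⟩, hr⟩, rfl⟩
    dsimp only at h' h
    have := h.flipX
    change L.Consec g f (L.row f.2 - 1)
    rw [h']
    simpa [Layout.flipX] using this

lemma ncard_both [Fintype W] (hF : L.Framed lo hi a b c) :
    {p ∈ L.Twins | L.row p.1.1 = L.row p.2.1}.ncard = L.Horiz.ncard := by
  refine Set.ncard_congr (fun p _ => (p.1.1, p.2.1)) ?_ ?_ ?_
  · rintro ⟨g, f⟩ ⟨h, hr⟩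
    dsimp only at hr ⊢
    have hc := hF.consec_fst h hr.ge
    have hXg := hF.X_of_fst hc.1.1 rfl
    have hXf := hF.X_of_fst hc.2.1.1 hr.symm
    have hlt : L.x g.1 < L.x f.1 := by
      have h1 := hF.le_of_mid_le hc.1 hc.2.1 hc.2.2.1.le
      rw [hXg, hXf] at h1
      exact lt_of_le_of_ne h1 fun h2 => twins_fst_ne h (hF.inj _ _ hr h2)
    have key : ∀ e, L.Spans e (L.row g.1) → L.x g.1 < L.X e (L.row g.1) →
        L.x f.1 ≤ L.X e (L.row g.1) := by
      intro e he h1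
      rw [← hXf]
      rw [← hXg] at h1
      exact hF.le_of_mid_le hc.2.1 he (hc.2.2.2 e he (hF.mid_lt_of_lt hc.1 he h1))
    refine ⟨hF.adj_horiz _ _ hr hlt (fun w hw hx => ?_) (fun e he => key e ⟨he.1, he.2.1.le, he.2.2⟩),
      hr, hlt⟩
    have hwh : L.row w < hi := by
      rw [hw]; exact hc.1.1.2.trans_le (hF.le_hi _)
    obtain ⟨z, hz⟩ := hF.exists_up hwh
    have h1 := key (w, z) (hw ▸ spans_fst hz)
    rw [hF.X_of_fst hz hw] at h1
    exact h1 hx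
  · rintro p q ⟨hp, hpr⟩ ⟨hq, hqr⟩ h
    exact hF.injOn_right ⟨hp, hpr.ge⟩ ⟨hq, hqr.ge⟩ (Prod.ext_iff.1 h).1
  · rintro ⟨u, v⟩ ⟨hadj, hr, hx⟩
    dsimp only at hadj hr hx
    have huc : u ≠ c := by
      rintro rfl
      exact hadj.ne' (hF.eq_of_row_hi v (hr.symm.trans hF.row_top))
    have hub : u ≠ b := by
      rintro rfl
      rcases hF.eq_of_row_lo v (hr.symm.trans hF.row_snd) with rfl | rfl
      · exact hx.not_gt hF.x_lt
      · exact lt_irrefl _ hx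
    obtain ⟨⟨g, f⟩, hp, hrf, rfl⟩ := hF.exists_right_twin hub huc
    dsimp only at hrf hr hx hadj
    have hc := hF.consec_fst hp hrf
    have hXg := hF.X_of_fst hc.1.1 rfl
    obtain ⟨z, hz⟩ := hF.exists_up (w := v) (by rw [← hr]; exact hF.lt_hi huc)
    have hsz : L.Spans (v, z) (L.row g.1) := hr ▸ spans_fst hz
    have hXz := hF.X_of_fst hz hr.symm
    have h1 := hF.le_of_mid_le hc.2.1 hsz
      (hc.2.2.2 _ hsz (hF.mid_lt_of_lt hc.1 hsz (by rwa [hXg, hXz])))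
    rw [hXz] at h1
    have h2 : L.x g.1 < L.X f (L.row g.1) := by
      rw [← hXg]
      refine lt_of_le_of_ne (hF.le_of_mid_le hc.1 hc.2.1 hc.2.2.1.le) fun h3 => ?_
      exact twins_fst_ne hp (by simpa using hF.fst_eq_of_X_eq hc.1 hc.2.1 h3)
    rcases hrf.lt_or_eq with h3 | h3
    · have hpass : L.Pass f (L.row g.1) := ⟨hc.2.1.1, h3, hc.2.1.2.2⟩
      exact absurd (le_antisymm h1 (hF.horiz_edge _ _ _ hadj hr hpass h2)) (hF.pass_ne hpass hr.symm)
    · rw [hF.X_of_fst hc.2.1.1 h3] at h1 h2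
      have h4 : f.1 = v := hF.inj _ _ (h3.trans hr)
        (le_antisymm h1 (hF.horiz_vertex _ _ _ hadj hr h3 h2))
      exact ⟨(g, f), ⟨hp, h3.symm⟩, by rw [← h4]⟩

lemma ncard_edgeSet_eq [Finite W] (hL : L.Valid) :
    L.G.edgeSet.ncard = {e | L.Up e}.ncard + L.Horiz.ncard := by
  have hdisj : Disjoint {e | L.Up e} L.Horiz :=
    Set.disjoint_left.2 fun e he hh => he.2.ne hh.2.1
  rw [← Set.ncard_union_eq hdisj (Set.toFinite _) (Set.toFinite _)]
  symm
  refine Set.ncard_congr (fun p _ => s(p.1, p.2)) ?_ ?_ ?_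
  · rintro p (hp | hp)
    · exact hp.1
    · exact hp.1
  · rintro ⟨u, v⟩ ⟨u', v'⟩ hp hq h
    rcases Sym2.eq_iff.1 h with ⟨h1, h2⟩ | ⟨h1, h2⟩
    · exact Prod.ext h1 h2
    · dsimp only at h1 h2
      subst h1 h2
      rcases hp with hp | hp <;> rcases hq with hq | hq
      · exact absurd hp.2 hq.2.not_gt
      · exact absurd hp.2 hq.2.1.not_gt
      · exact absurd hq.2 hp.2.1.not_gt
      · exact absurd hp.2.2 hq.2.2.not_gt
  · intro e he
    induction e with
    | h u v =>
      have he : L.G.Adj u v := he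
      rcases lt_trichotomy (L.row u) (L.row v) with h | h | h
      · exact ⟨(u, v), Or.inl ⟨he, h⟩, rfl⟩
      · rcases lt_trichotomy (L.x u) (L.x v) with h' | h' | h'
        · exact ⟨(u, v), Or.inr ⟨he, h, h'⟩, rfl⟩
        · exact absurd (hL.inj u v h h') he.ne
        · exact ⟨(v, u), Or.inr ⟨he.symm, h.symm, h'⟩, Sym2.eq_swap⟩
      · exact ⟨(v, u), Or.inl ⟨he.symm, h⟩, Sym2.eq_swap⟩

theorem ncard_edgeSet [Fintype W] (hF : L.Framed lo hi a b c) :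
    L.G.edgeSet.ncard + 6 = 3 * Fintype.card W := by
  have hU : {p ∈ L.Twins | L.row p.2.1 ≤ L.row p.1.1} ∪ {p ∈ L.Twins | L.row p.1.1 ≤ L.row p.2.1}
      = L.Twins := by
    ext p
    constructor
    · rintro (h | h) <;> exact h.1
    · intro h
      exact (le_total (L.row p.2.1) (L.row p.1.1)).imp (fun k => ⟨h, k⟩) fun k => ⟨h, k⟩
  have hI : {p ∈ L.Twins | L.row p.2.1 ≤ L.row p.1.1} ∩ {p ∈ L.Twins | L.row p.1.1 ≤ L.row p.2.1}
      = {p ∈ L.Twins | L.row p.1.1 = L.row p.2.1} := by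
    ext p
    exact ⟨fun h => ⟨h.1.1, le_antisymm h.2.2 h.1.2⟩, fun h => ⟨⟨h.1, h.2.ge⟩, h.1, h.2.le⟩⟩
  have h1 := Set.ncard_union_add_ncard_inter {p ∈ L.Twins | L.row p.2.1 ≤ L.row p.1.1}
    {p ∈ L.Twins | L.row p.1.1 ≤ L.row p.2.1}
  rw [hU, hI, hF.ncard_both] at h1
  have h2 := hF.ncard_right
  have h3 := hF.ncard_left
  have h4 := hF.ncard_up
  have h5 := ncard_edgeSet_eq hF.toValid
  omega

end Framed

/-- A valid layout framed by edges from `a` and `b` in the bottom row to `c` in the top row. -/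
structure Frame (L : Layout W) (lo hi : ℤ) (a b c : W) : Prop extends L.Valid where
  lo_le : ∀ w, lo ≤ L.row w
  le_hi : ∀ w, L.row w ≤ hi
  row_fst : L.row a = lo
  row_snd : L.row b = lo
  row_top : L.row c = hi
  eq_of_row_lo : ∀ w, L.row w = lo → w = a ∨ w = b
  eq_of_row_hi : ∀ w, L.row w = hi → w = c
  x_lt : L.x a < L.x b
  up_fst : L.Up (a, c)
  up_snd : L.Up (b, c)
  lt_x : ∀ w, lo < L.row w → L.row w < hi → L.X (a, c) (L.row w) < L.x w
  x_lt' : ∀ w, lo < L.row w → L.row w < hi → L.x w < L.X (b, c) (L.row w)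

namespace Frame

variable {L : Layout W} {lo hi : ℤ} {a b c : W}

lemma of_valid (hF : L.Frame lo hi a b c) {u v : W} (huv : ¬ L.G.Adj u v) {X : W × W → ℤ → ℝ}
    (hX : ∀ f, f ≠ (u, v) → X f = L.X f)
    (hV : (Layout.mk L.row L.x (L.G ⊔ SimpleGraph.edge u v) X).Valid) :
    (Layout.mk L.row L.x (L.G ⊔ SimpleGraph.edge u v) X).Frame lo hi a b c where
  toValid := hV
  lo_le := hF.lo_le
  le_hi := hF.le_hi
  row_fst := hF.row_fst
  row_snd := hF.row_snd
  row_top := hF.row_top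
  eq_of_row_lo := hF.eq_of_row_lo
  eq_of_row_hi := hF.eq_of_row_hi
  x_lt := hF.x_lt
  up_fst := ⟨Or.inl hF.up_fst.1, hF.up_fst.2⟩
  up_snd := ⟨Or.inl hF.up_snd.1, hF.up_snd.2⟩
  lt_x w h1 h2 := by
    have := hF.lt_x w h1 h2
    rwa [← hX (a, c) fun h => huv (by rw [Prod.mk.injEq] at h; exact h.1 ▸ h.2 ▸ hF.up_fst.1)] at this
  x_lt' w h1 h2 := by
    have := hF.x_lt' w h1 h2
    rwa [← hX (b, c) fun h => huv (by rw [Prod.mk.injEq] at h; exact h.1 ▸ h.2 ▸ hF.up_snd.1)] at this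

lemma framed_of_maximal [Finite W] (hF : L.Frame lo hi a b c)
    (hmax : ∀ u v X, u ≠ v →
      (Layout.mk L.row L.x (L.G ⊔ SimpleGraph.edge u v) X).Frame lo hi a b c → L.G.Adj u v) :
    L.Framed lo hi a b c where
  toValid := hF.toValid
  lo_le := hF.lo_le
  le_hi := hF.le_hi
  exists_up_of_lo w hw := by
    rcases hF.eq_of_row_lo w hw with rfl | rfl
    · exact ⟨c, hF.up_fst⟩
    · exact ⟨c, hF.up_snd⟩
  exists_up_of_hi w hw := by
    obtain rfl := hF.eq_of_row_hi w hw
    exact ⟨a, hF.up_fst⟩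
  exists_right w h1 h2 :=
    ⟨(b, c), ⟨hF.up_snd, hF.row_snd.trans_lt h1, h2.trans_eq hF.row_top.symm⟩, hF.x_lt' w h1 h2⟩
  exists_left w h1 h2 :=
    ⟨(a, c), ⟨hF.up_fst, hF.row_fst.trans_lt h1, h2.trans_eq hF.row_top.symm⟩, hF.lt_x w h1 h2⟩
  adj_left u v e hu hv huv := by
    by_contra hn
    obtain ⟨X, hX, hV⟩ := hF.exists_insert hu hv huv
    exact hn (hmax u v X (fun h => huv.ne (congrArg L.row h)) (hF.of_valid hn hX hV))
  adj_right u v e hu hv huv := by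
    by_contra hn
    obtain ⟨X, hX, hV⟩ := hF.toValid.flipX.exists_insert hu hv huv
    have hV' := hV.flipX
    simp only [Layout.flipX, neg_neg] at hV'
    exact hn (hmax u v _ (fun h => huv.ne (congrArg L.row h)) (hF.of_valid hn (fun f hf => by
      funext r
      rw [hX f hf]
      simp [Layout.flipX]) hV'))
  adj_horiz u v huv hlt h1 h2 := by
    by_contra hn
    exact hn (hmax u v _ (fun h => hlt.ne (congrArg L.x h))
      (hF.of_valid hn (fun _ _ => rfl) (hF.insert_horiz huv hlt h1 h2)))
  row_fst := hF.row_fst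
  row_snd := hF.row_snd
  row_top := hF.row_top
  eq_of_row_lo := hF.eq_of_row_lo
  eq_of_row_hi := hF.eq_of_row_hi
  x_lt := hF.x_lt
  up_fst := hF.up_fst
  up_snd := hF.up_snd

theorem exists_framed [Finite W] (hF : L.Frame lo hi a b c) :
    ∃ G X, L.G ≤ G ∧ (Layout.mk L.row L.x G X).Framed lo hi a b c := by
  obtain ⟨G, hG, ⟨X, hX⟩, hmax⟩ := (Set.toFinite
    {G | ∃ X, (Layout.mk L.row L.x G X).Frame lo hi a b c}).exists_le_maximal (a := L.G) ⟨L.X, hF⟩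
  refine ⟨G, X, hG, hX.framed_of_maximal fun u v X' huv h => ?_⟩
  exact hmax ⟨X', h⟩ le_sup_left ((sup_edge_adj huv).2 (Or.inr (Or.inl ⟨rfl, rfl⟩)))

end Frame

end Layout

/-- The polygonal chain through the points `(f r, r), …, (f (r + n), r + n)`. -/
def rowChain (f : ℤ → ℝ) (r : ℤ) : ℕ → List Pt
  | 0 => [(f r, (r : ℝ))]
  | n + 1 => (f r, (r : ℝ)) :: rowChain f (r + 1) n

lemma rowChain_eq_cons (f : ℤ → ℝ) (r : ℤ) (n : ℕ) :
    ∃ l, rowChain f r n = (f r, (r : ℝ)) :: l := by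
  cases n <;> exact ⟨_, rfl⟩

lemma head?_rowChain (f : ℤ → ℝ) (r : ℤ) (n : ℕ) :
    (rowChain f r n).head? = some (f r, (r : ℝ)) := by
  obtain ⟨l, hl⟩ := rowChain_eq_cons f r n
  rw [hl, List.head?_cons]

lemma getLast?_rowChain (f : ℤ → ℝ) (r : ℤ) (n : ℕ) :
    (rowChain f r n).getLast? = some (f (r + n), ((r + n : ℤ) : ℝ)) := by
  induction n generalizing r with
  | zero => simp [rowChain]
  | succ n ih =>
    have h := ih (r + 1)
    obtain ⟨l, hl⟩ := rowChain_eq_cons f (r + 1) n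
    rw [rowChain]
    rw [hl] at h ⊢
    rw [List.getLast?_cons_cons, h]
    push_cast
    rw [show r + 1 + (n : ℤ) = r + (n + 1) by ring, show (r : ℝ) + 1 + n = r + (n + 1) by ring]

lemma exists_of_mem_rowChain {f : ℤ → ℝ} {r : ℤ} {n : ℕ} {p : Pt} (hp : p ∈ rowChain f r n) :
    ∃ k : ℤ, r ≤ k ∧ k ≤ r + n ∧ p = (f k, (k : ℝ)) := by
  induction n generalizing r with
  | zero => exact ⟨r, le_rfl, by simp, by simpa [rowChain] using hp⟩
  | succ n ih =>
    rw [rowChain, List.mem_cons] at hp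
    rcases hp with rfl | hp
    · exact ⟨r, le_rfl, by push_cast; omega, rfl⟩
    · obtain ⟨k, h1, h2, h3⟩ := ih hp
      exact ⟨k, by omega, by push_cast; omega, h3⟩

lemma chain_rowChain (f : ℤ → ℝ) (r : ℤ) (n : ℕ) :
    List.IsChain (· ≤ ·) ((rowChain f r n).map Prod.snd) := by
  induction n generalizing r with
  | zero => simp [rowChain]
  | succ n ih =>
    have h := ih (r + 1)
    obtain ⟨l, hl⟩ := rowChain_eq_cons f (r + 1) n
    rw [rowChain]
    rw [hl] at h ⊢
    rw [List.map_cons] at h ⊢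
    rw [List.map_cons, List.isChain_cons_cons]
    exact ⟨by push_cast; linarith, h⟩

lemma exists_graph_rowChain (f : ℤ → ℝ) (r : ℤ) (n : ℕ) :
    ∃ g : ℝ → ℝ, Continuous g ∧ g r = f r ∧
      (∀ k : ℤ, r ≤ k → k < r + n → ∀ t : ℝ, 0 ≤ t → t ≤ 1 →
        g (k + t) = (1 - t) * f k + t * f (k + 1)) ∧
      chainSet (rowChain f r n) = {p | (r : ℝ) ≤ p.2 ∧ p.2 ≤ (r : ℝ) + n ∧ p.1 = g p.2} := by
  induction n generalizing r with
  | zero =>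
    refine ⟨fun _ => f r, continuous_const, rfl, fun k h1 h2 => ?_, ?_⟩
    · simp at h2; omega
    · ext ⟨a, b⟩
      simp only [rowChain, chainSet, mem_singleton_iff, mem_ofPred_eq, Prod.mk.injEq,
        Nat.cast_zero, add_zero]
      constructor
      · rintro ⟨rfl, rfl⟩; exact ⟨le_rfl, le_rfl, rfl⟩
      · rintro ⟨h1, h2, rfl⟩; exact ⟨rfl, le_antisymm h2 h1⟩
  | succ n ih =>
    obtain ⟨g, hg, hgr, hgk, hgs⟩ := ih (r + 1)
    push_cast at hgr hgs
    set lin : ℝ → ℝ := fun y => f r + (y - r) * (f (r + 1) - f r) with hlin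
    refine ⟨fun y => if y ≤ r + 1 then lin y else g y, ?_, ?_, ?_, ?_⟩
    · refine Continuous.if_le (by rw [hlin]; fun_prop) hg continuous_id continuous_const ?_
      rintro y rfl
      simp only [hlin]
      rw [hgr]; ring
    · simp [hlin]
    · intro k h1 h2 t ht0 ht1
      rcases h1.eq_or_lt with rfl | h1
      · dsimp only
        rw [if_pos (by linarith), hlin]; ring
      · have hk : (r : ℝ) + 1 ≤ k := by exact_mod_cast h1
        have hgk' := hgk k h1 (by push_cast at h2; omega) t ht0 ht1
        dsimp only
        split_ifs with h
        · have ht : t = 0 := by linarith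
          have hkr : k = r + 1 := by
            have : (k : ℝ) = ((r + 1 : ℤ) : ℝ) := by push_cast; linarith
            exact_mod_cast this
          subst ht hkr
          simp only [hlin]; push_cast; ring
        · exact hgk'
    · obtain ⟨l, hl⟩ := rowChain_eq_cons f (r + 1) n
      rw [rowChain]
      rw [hl] at hgs ⊢
      rw [chainSet, hgs]
      ext ⟨a, b⟩
      simp only [mem_union, mem_ofPred_eq, segment_eq_image, mem_image, mem_Icc, Prod.smul_mk,
        smul_eq_mul, Prod.mk_add_mk, Prod.mk.injEq]
      push_cast
      constructor
      · rintro (⟨t, ⟨h0, h1⟩, h2, h3⟩ | ⟨h1, h2, h3⟩)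
        · have hb : b = r + t := by rw [← h3]; ring
          refine ⟨by linarith, ?_, ?_⟩
          · have : (0 : ℝ) ≤ n := Nat.cast_nonneg n
            linarith
          · rw [if_pos (by linarith), hlin, hb, ← h2]; ring
        · refine ⟨by linarith, by linarith, ?_⟩
          split_ifs with h
          · have hb : b = r + 1 := le_antisymm h h1
            rw [h3, hb, hgr, hlin]; ring
          · exact h3
      · rintro ⟨h1, h2, h3⟩
        split_ifs at h3 with h
        · left
          refine ⟨b - r, ⟨by linarith, by linarith⟩, ?_, by ring⟩
          rw [h3, hlin]; ring
        · right
          exact ⟨by linarith, by linarith, h3⟩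

lemma IsSimpleArc.symm {S : Set Pt} {a b : Pt} (h : IsSimpleArc S a b) : IsSimpleArc S b a := by
  obtain ⟨γ, hc, hi, himg, h0, h1⟩ := h
  have hm : MapsTo (fun t : ℝ => 1 - t) (Icc 0 1) (Icc 0 1) := fun t ht =>
    ⟨by linarith [ht.2], by linarith [ht.1]⟩
  refine ⟨fun t => γ (1 - t), hc.comp (by fun_prop) hm, ?_, ?_, by simpa using h1,
    by simpa using h0⟩
  · intro s hs t ht hst
    have := hi (hm hs) (hm ht) hst
    linarith
  · rw [← himg]
    ext p
    constructor
    · rintro ⟨t, ht, rfl⟩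
      exact ⟨1 - t, hm ht, rfl⟩
    · rintro ⟨t, ht, rfl⟩
      exact ⟨1 - t, hm ht, by simp⟩

lemma isSimpleArc_segment {p q : Pt} (h : p ≠ q) : IsSimpleArc (chainSet [p, q]) p q := by
  refine ⟨fun t => AffineMap.lineMap p q t, ?_, ?_, ?_, by simp, by simp⟩
  · exact (AffineMap.lineMap_continuous (R := ℝ)).continuousOn
  · exact (AffineMap.lineMap_injective ℝ h).injOn
  · rw [chainSet, chainSet, union_eq_self_of_subset_right
      (singleton_subset_iff.2 (right_mem_segment ℝ p q)), segment_eq_image_lineMap]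

lemma isSimpleArc_rowChain (f : ℤ → ℝ) (r : ℤ) {n : ℕ} (hn : n ≠ 0) :
    IsSimpleArc (chainSet (rowChain f r n)) (f r, (r : ℝ)) (f (r + n), ((r + n : ℤ) : ℝ)) := by
  obtain ⟨g, hg, hgr, hgk, hgs⟩ := exists_graph_rowChain f r n
  have hn' : (0 : ℝ) < n := by exact_mod_cast Nat.pos_of_ne_zero hn
  refine ⟨fun t => (g (r + n * t), r + n * t), by fun_prop, ?_, ?_, by simp [hgr], ?_⟩
  · intro s _ t _ h
    have := (Prod.ext_iff.1 h).2
    dsimp only at this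
    exact mul_left_cancel₀ hn'.ne' (add_left_cancel this)
  · rw [hgs]
    ext ⟨a, b⟩
    constructor
    · rintro ⟨t, ⟨h0, h1⟩, h⟩
      obtain ⟨rfl, rfl⟩ := Prod.mk.inj h
      exact ⟨by nlinarith, by nlinarith, rfl⟩
    · rintro ⟨h1, h2, h3⟩
      dsimp only at h1 h2 h3
      have hb : (r : ℝ) + n * ((b - r) / n) = b := by field_simp; ring
      refine ⟨(b - r) / n, ⟨div_nonneg (by linarith) hn'.le, (div_le_one hn').2 (by linarith)⟩, ?_⟩
      dsimp only
      rw [hb, h3]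
  · have h := hgk (r + n - 1) (by omega) (by omega) 1 zero_le_one le_rfl
    push_cast at h ⊢
    rw [mul_one]
    rw [show (r : ℝ) + n - 1 + 1 = r + n by ring] at h
    rw [h, sub_add_cancel]
    simp

lemma mem_chainSet_rowChain {f : ℤ → ℝ} {r : ℤ} {n : ℕ} {p : Pt} (hn : n ≠ 0)
    (hp : p ∈ chainSet (rowChain f r n)) :
    (∃ k : ℤ, r ≤ k ∧ k ≤ r + n ∧ p = (f k, (k : ℝ))) ∨
    ∃ k : ℤ, r ≤ k ∧ k < r + n ∧ ∃ t : ℝ, 0 < t ∧ t < 1 ∧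
      p = ((1 - t) * f k + t * f (k + 1), k + t) := by
  obtain ⟨g, hg, hgr, hgk, hgs⟩ := exists_graph_rowChain f r n
  rw [hgs] at hp
  obtain ⟨x, y⟩ := p
  obtain ⟨h1, h2, h3⟩ := hp
  dsimp only at h1 h2 h3
  subst h3
  have hk1 : r ≤ ⌊y⌋ := Int.le_floor.2 h1
  have hy : (⌊y⌋ : ℝ) + Int.fract y = y := Int.floor_add_fract y
  have hk2 : ⌊y⌋ ≤ r + n := by
    have : (⌊y⌋ : ℝ) ≤ ((r + n : ℤ) : ℝ) := by push_cast; linarith [Int.fract_nonneg y]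
    exact_mod_cast this
  rcases (Int.fract_nonneg y).eq_or_lt with h | h
  · left
    refine ⟨⌊y⌋, hk1, hk2, ?_⟩
    have hy' : (⌊y⌋ : ℝ) = y := by linarith
    rcases hk2.lt_or_eq with hlt | heq
    · have := hgk ⌊y⌋ hk1 hlt 0 le_rfl zero_le_one
      rw [add_zero, hy'] at this
      rw [this, hy']; simp
    · have := hgk (⌊y⌋ - 1) (by omega) (by omega) 1 zero_le_one le_rfl
      push_cast at this
      rw [sub_add_cancel, hy', sub_add_cancel] at this
      rw [this, hy']; simp
  · right
    have hlt : ⌊y⌋ < r + n := by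
      have : (⌊y⌋ : ℝ) < ((r + n : ℤ) : ℝ) := by push_cast; linarith
      exact_mod_cast this
    refine ⟨⌊y⌋, hk1, hlt, Int.fract y, h, Int.fract_lt_one y, ?_⟩
    rw [← hgk ⌊y⌋ hk1 hlt _ h.le (Int.fract_lt_one y).le, hy]

namespace Layout

variable {W : Type}

/-- The polygonal chain of an edge that is directed upwards or to the right. -/
def edgeChain (L : Layout W) (e : W × W) : List Pt :=
  if L.row e.1 < L.row e.2 then rowChain (L.X e) (L.row e.1) (L.row e.2 - L.row e.1).toNat
  else [(L.x e.1, (L.row e.1 : ℝ)), (L.x e.2, (L.row e.2 : ℝ))]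

/-- The polygonal chain of an undirected edge. -/
noncomputable def arc (L : Layout W) (s : Sym2 W) : List Pt :=
  open Classical in
  if h : ∃ e : W × W, (L.Up e ∨ e ∈ L.Horiz) ∧ s(e.1, e.2) = s then L.edgeChain h.choose else []

/-- The point of a vertex. -/
def pt (L : Layout W) (w : W) : Pt := (L.x w, (L.row w : ℝ))

lemma edgeChain_of_up {L : Layout W} {e : W × W} (he : L.Up e) :
    ∃ n : ℕ, n ≠ 0 ∧ L.row e.1 + n = L.row e.2 ∧
      L.edgeChain e = rowChain (L.X e) (L.row e.1) n := by
  have h := he.2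
  refine ⟨(L.row e.2 - L.row e.1).toNat, ?_, ?_, if_pos h⟩
  · omega
  · omega

lemma edgeChain_of_horiz {L : Layout W} {e : W × W} (he : e ∈ L.Horiz) :
    L.edgeChain e = [L.pt e.1, L.pt e.2] := if_neg he.2.1.not_lt

namespace Valid

variable {L : Layout W}

lemma exists_directed (hL : L.Valid) {s : Sym2 W} (hs : s ∈ L.G.edgeSet) :
    ∃ e : W × W, (L.Up e ∨ e ∈ L.Horiz) ∧ s(e.1, e.2) = s := by
  induction s with
  | h u v =>
    have he : L.G.Adj u v := hs
    rcases lt_trichotomy (L.row u) (L.row v) with h | h | h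
    · exact ⟨(u, v), Or.inl ⟨he, h⟩, rfl⟩
    · rcases lt_trichotomy (L.x u) (L.x v) with h' | h' | h'
      · exact ⟨(u, v), Or.inr ⟨he, h, h'⟩, rfl⟩
      · exact absurd (hL.inj u v h h') he.ne
      · exact ⟨(v, u), Or.inr ⟨he.symm, h.symm, h'⟩, Sym2.eq_swap⟩
    · exact ⟨(v, u), Or.inl ⟨he.symm, h⟩, Sym2.eq_swap⟩

lemma exists_arc_eq (hL : L.Valid) {s : Sym2 W} (hs : s ∈ L.G.edgeSet) :
    ∃ e : W × W, (L.Up e ∨ e ∈ L.Horiz) ∧ s(e.1, e.2) = s ∧ L.arc s = L.edgeChain e := by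
  have h := hL.exists_directed hs
  exact ⟨h.choose, h.choose_spec.1, h.choose_spec.2, dif_pos h⟩

lemma pt_injective (hL : L.Valid) : Function.Injective L.pt := fun u v h => by
  obtain ⟨h1, h2⟩ := Prod.mk.inj h
  exact hL.inj u v (by exact_mod_cast h2) h1

lemma edgeChain_ends (hL : L.Valid) {e : W × W} (he : L.Up e ∨ e ∈ L.Horiz) :
    (L.edgeChain e).head? = some (L.pt e.1) ∧ (L.edgeChain e).getLast? = some (L.pt e.2) := by
  rcases he with he | he
  · obtain ⟨n, hn, hr, heq⟩ := edgeChain_of_up he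
    rw [heq, head?_rowChain, getLast?_rowChain, hr, hL.X_fst e he, hL.X_snd e he]
    exact ⟨rfl, rfl⟩
  · rw [edgeChain_of_horiz he]
    exact ⟨rfl, rfl⟩

lemma isSimpleArc_edgeChain (hL : L.Valid) {e : W × W} (he : L.Up e ∨ e ∈ L.Horiz) :
    IsSimpleArc (chainSet (L.edgeChain e)) (L.pt e.1) (L.pt e.2) := by
  rcases he with he | he
  · obtain ⟨n, hn, hr, heq⟩ := edgeChain_of_up he
    have h := isSimpleArc_rowChain (L.X e) (L.row e.1) hn
    rw [hr, hL.X_fst e he, hL.X_snd e he] at h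
    rw [heq]
    exact h
  · rw [edgeChain_of_horiz he]
    exact isSimpleArc_segment (hL.pt_injective.ne he.1.ne)

/-- The drawing described by a valid layout. -/
noncomputable def drawing (hL : L.Valid) : PolyDrawing L.G where
  pos := L.pt
  pos_inj := hL.pt_injective
  arc := L.arc
  arc_ends u v h := by
    obtain ⟨e, he, hs, harc⟩ := hL.exists_arc_eq (s := s(u, v)) h
    rw [harc]
    rcases Sym2.eq_iff.1 hs with ⟨h1, h2⟩ | ⟨h1, h2⟩ <;> subst h1 h2
    · exact Or.inl (hL.edgeChain_ends he)
    · exact Or.inr (hL.edgeChain_ends he)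
  arc_simple u v h := by
    obtain ⟨e, he, hs, harc⟩ := hL.exists_arc_eq (s := s(u, v)) h
    rw [harc]
    rcases Sym2.eq_iff.1 hs with ⟨h1, h2⟩ | ⟨h1, h2⟩ <;> subst h1 h2
    · exact hL.isSimpleArc_edgeChain he
    · exact (hL.isSimpleArc_edgeChain he).symm

lemma mem_edgeChain_of_up {e : W × W} (he : L.Up e) {p : Pt} (hp : p ∈ chainSet (L.edgeChain e)) :
    (∃ k : ℤ, L.row e.1 ≤ k ∧ k ≤ L.row e.2 ∧ p = (L.X e k, (k : ℝ))) ∨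
    ∃ k : ℤ, L.Spans e k ∧ ∃ t : ℝ, 0 < t ∧ t < 1 ∧
      p = ((1 - t) * L.X e k + t * L.X e (k + 1), k + t) := by
  obtain ⟨n, hn, hr, heq⟩ := edgeChain_of_up he
  rw [heq] at hp
  rcases mem_chainSet_rowChain hn hp with ⟨k, h1, h2, h3⟩ | ⟨k, h1, h2, t, h3⟩
  · exact Or.inl ⟨k, h1, hr ▸ h2, h3⟩
  · exact Or.inr ⟨k, ⟨he, h1, hr ▸ h2⟩, t, h3⟩

lemma mem_edgeChain_of_horiz {e : W × W} (he : e ∈ L.Horiz) {p : Pt}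
    (hp : p ∈ chainSet (L.edgeChain e)) :
    p.2 = L.row e.1 ∧ L.x e.1 ≤ p.1 ∧ p.1 ≤ L.x e.2 := by
  rw [edgeChain_of_horiz he, chainSet, chainSet, union_eq_self_of_subset_right
    (singleton_subset_iff.2 (right_mem_segment ℝ _ _)), segment_eq_image] at hp
  obtain ⟨t, ⟨h0, h1⟩, rfl⟩ := hp
  have hx := he.2.2
  simp only [pt, he.2.1, Prod.smul_mk, Prod.mk_add_mk, smul_eq_mul]
  exact ⟨by ring, by nlinarith, by nlinarith⟩

lemma int_ne {k l : ℤ} {t : ℝ} (h0 : 0 < t) (h1 : t < 1) : (l : ℝ) + t ≠ k := fun h => by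
  have h2 : (l : ℝ) < k := by linarith
  have h3 : (k : ℝ) < ((l + 1 : ℤ) : ℝ) := by push_cast; linarith
  have h4 : l < k := by exact_mod_cast h2
  have h5 : k < l + 1 := by exact_mod_cast h3
  omega

lemma eq_of_pt_mem (hL : L.Valid) {e : W × W} (he : L.Up e ∨ e ∈ L.Horiz) {w : W}
    (hw : L.pt w ∈ chainSet (L.edgeChain e)) : w = e.1 ∨ w = e.2 := by
  rcases he with he | he
  · rcases mem_edgeChain_of_up he hw with ⟨k, h1, h2, h3⟩ | ⟨k, -, t, h0, h1, h3⟩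
    · obtain ⟨hx, hr⟩ := Prod.mk.inj h3
      have hr : L.row w = k := by exact_mod_cast hr
      rcases h1.eq_or_lt with h1 | h1
      · rw [hL.X_of_fst he h1] at hx
        exact Or.inl (hL.inj _ _ (hr.trans h1.symm) hx)
      rcases h2.eq_or_lt with h2 | h2
      · rw [hL.X_of_snd he h2.symm] at hx
        exact Or.inr (hL.inj _ _ (hr.trans h2) hx)
      · exact absurd hx.symm (hL.pass_ne ⟨he, h1, h2⟩ hr)
    · exact absurd (Prod.mk.inj h3).2.symm (int_ne h0 h1)
  · obtain ⟨h1, h2, h3⟩ := mem_edgeChain_of_horiz he hw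
    have hr : L.row w = L.row e.1 := Int.cast_injective h1
    rcases h2.eq_or_lt with h2 | h2
    · exact Or.inl (hL.inj _ _ hr h2.symm)
    · exact Or.inr (hL.inj _ _ (hr.trans he.2.1)
        (le_antisymm h3 (hL.horiz_vertex _ _ _ he.1 he.2.1 hr h2)))

/-- An edge contains no point of another edge in its interior. -/
lemma exists_eq_pt (hL : L.Valid) {e f : W × W} (he : L.Up e ∨ e ∈ L.Horiz)
    (hf : L.Up f ∨ f ∈ L.Horiz) (hef : e ≠ f) {p : Pt} (hpe : p ∈ chainSet (L.edgeChain e))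
    (hpf : p ∈ chainSet (L.edgeChain f)) : ∃ w, p = L.pt w := by
  have huh : ∀ e f : W × W, L.Up e → f ∈ L.Horiz → p ∈ chainSet (L.edgeChain e) →
      p ∈ chainSet (L.edgeChain f) → ∃ w, p = L.pt w := by
    intro e f he hf hpe hpf
    obtain ⟨h1, h2, h3⟩ := mem_edgeChain_of_horiz hf hpf
    rcases mem_edgeChain_of_up he hpe with ⟨k, k1, k2, rfl⟩ | ⟨k, -, t, k0, k1, rfl⟩
    · dsimp only at h1 h2 h3
      obtain rfl : k = L.row f.1 := by exact_mod_cast h1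
      rcases k1.eq_or_lt with k1 | k1
      · exact ⟨e.1, by rw [hL.X_of_fst he k1, pt, k1]⟩
      rcases k2.eq_or_lt with k2 | k2
      · exact ⟨e.2, by rw [hL.X_of_snd he k2.symm, pt, k2]⟩
      have hpass : L.Pass e (L.row f.1) := ⟨he, k1, k2⟩
      have h4 := hL.horiz_edge _ _ e hf.1 hf.2.1 hpass
        (lt_of_le_of_ne h2 (hL.pass_ne hpass rfl).symm)
      exact absurd (le_antisymm h3 h4) (hL.pass_ne hpass hf.2.1.symm)
    · exact absurd h1 (int_ne k0 k1)
  rcases he with he | he <;> rcases hf with hf | hf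
  · rcases mem_edgeChain_of_up he hpe with ⟨k, k1, k2, rfl⟩ | ⟨k, hk, t, k0, k1, rfl⟩
    · rcases mem_edgeChain_of_up hf hpf with ⟨l, l1, l2, h⟩ | ⟨l, hl, t, l0, l1, h⟩
      · obtain ⟨hx, hr⟩ := Prod.mk.inj h
        obtain rfl : k = l := by exact_mod_cast hr
        rcases k1.eq_or_lt with k1 | k1
        · exact ⟨e.1, by rw [hL.X_of_fst he k1, pt, k1]⟩
        rcases k2.eq_or_lt with k2 | k2
        · exact ⟨e.2, by rw [hL.X_of_snd he k2.symm, pt, k2]⟩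
        exact absurd (hL.eq_of_pass ⟨he, k1, k2⟩ hf l1 l2 hx) hef
      · exact absurd (Prod.mk.inj h).2.symm (int_ne l0 l1)
    · rcases mem_edgeChain_of_up hf hpf with ⟨l, l1, l2, h⟩ | ⟨l, hl, s, l0, l1, h⟩
      · exact absurd (Prod.mk.inj h).2 (int_ne k0 k1)
      · obtain ⟨hx, hr⟩ := Prod.mk.inj h
        obtain rfl : k = l := by
          have h1 : (k : ℝ) < ((l + 1 : ℤ) : ℝ) := by push_cast; linarith
          have h2 : (l : ℝ) < ((k + 1 : ℤ) : ℝ) := by push_cast; linarith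
          have h1 : k < l + 1 := by exact_mod_cast h1
          have h2 : l < k + 1 := by exact_mod_cast h2
          omega
        obtain rfl : t = s := by linarith
        have aux : ∀ a b : W × W, L.Spans a k → L.Spans b k →
            (1 - t) * L.X a k + t * L.X a (k + 1) = (1 - t) * L.X b k + t * L.X b (k + 1) →
            L.X b k ≤ L.X a k := by
          intro a b ha hb hab
          by_contra! hlt
          have := hL.cross a b k ha hb hlt
          nlinarith
        have h1 := le_antisymm (aux f e hl hk hx.symm) (aux e f hk hl hx)
        rw [h1] at hx
        have h2 : L.X e (k + 1) = L.X f (k + 1) := mul_left_cancel₀ k0.ne' (add_left_cancel hx)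
        exact absurd (hL.eq_of_mid_eq hk hl (by rw [mid, mid, h1, h2])) hef
  · exact huh e f he hf hpe hpf
  · exact huh f e hf he hpf hpe
  · obtain ⟨h1, h2, h3⟩ := mem_edgeChain_of_horiz he hpe
    obtain ⟨k1, k2, k3⟩ := mem_edgeChain_of_horiz hf hpf
    have hr : L.row e.1 = L.row f.1 := by exact_mod_cast h1.symm.trans k1
    rcases lt_trichotomy (L.x e.1) (L.x f.1) with h | h | h
    · have := hL.horiz_vertex _ _ f.1 he.1 he.2.1 hr.symm h
      exact ⟨f.1, Prod.ext (le_antisymm (h3.trans this) k2) k1⟩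
    · have e1 : e.1 = f.1 := hL.inj _ _ hr h
      have r2 : L.row e.2 = L.row f.2 := he.2.1.symm.trans (hr.trans hf.2.1)
      have i1 := hL.horiz_vertex _ _ f.2 he.1 he.2.1 (r2.symm.trans he.2.1.symm)
        (h.trans_lt hf.2.2)
      have i2 := hL.horiz_vertex _ _ e.2 hf.1 hf.2.1 (r2.trans hf.2.1.symm)
        (h.symm.trans_lt he.2.2)
      exact absurd (Prod.ext e1 (hL.inj _ _ r2 (le_antisymm i1 i2))) hef
    · have := hL.horiz_vertex _ _ e.1 hf.1 hf.2.1 hr h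
      exact ⟨e.1, Prod.ext (le_antisymm (k3.trans this) h2) h1⟩

theorem drawing_isPlanar (hL : L.Valid) : hL.drawing.IsPlanar := by
  have key : ∀ s ∈ L.G.edgeSet, ∀ w, L.pt w ∈ chainSet (L.arc s) → w ∈ s := by
    intro s hs w hw
    obtain ⟨e, he, rfl, harc⟩ := hL.exists_arc_eq hs
    rw [harc] at hw
    exact Sym2.mem_iff.2 (hL.eq_of_pt_mem he hw)
  refine ⟨fun v s hs hv hmem => hv (key s hs v hmem), fun s hs s' hs' hne p hp => ?_⟩
  obtain ⟨w, hw⟩ : ∃ w, p = L.pt w := by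
    obtain ⟨e, he, rfl, harc⟩ := hL.exists_arc_eq hs
    obtain ⟨f, hf, rfl, harc'⟩ := hL.exists_arc_eq hs'
    have h1 : p ∈ chainSet (L.arc _) := hp.1
    have h2 : p ∈ chainSet (L.arc _) := hp.2
    rw [harc] at h1
    rw [harc'] at h2
    exact hL.exists_eq_pt he hf (fun h => hne (by rw [h])) h1 h2
  have h1 := hp.1
  have h2 := hp.2
  rw [hw] at h1 h2
  exact ⟨w, key s hs w h1, key s' hs' w h2, hw⟩

theorem drawing_isYMonotone (hL : L.Valid) : hL.drawing.IsYMonotone := by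
  intro s hs
  obtain ⟨e, he, rfl, harc⟩ := hL.exists_arc_eq hs
  left
  change List.IsChain (· ≤ ·) ((L.arc _).map Prod.snd)
  rw [harc]
  rcases he with he | he
  · obtain ⟨n, -, -, heq⟩ := edgeChain_of_up he
    rw [heq]
    exact chain_rowChain _ _ _
  · rw [edgeChain_of_horiz he]
    simp [pt, he.2.1]

theorem drawing_hasHeight (hL : L.Valid) {h : ℕ} (h1 : ∀ w, 1 ≤ L.row w) (h2 : ∀ w, L.row w ≤ h) :
    hL.drawing.HasHeight h := by
  refine ⟨fun w => ⟨L.row w, h1 w, h2 w, rfl⟩, fun s hs p hp => ?_⟩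
  obtain ⟨e, he, rfl, harc⟩ := hL.exists_arc_eq hs
  change p ∈ chainBends (L.arc _) at hp
  rw [harc] at hp
  rcases he with he | he
  · obtain ⟨n, -, hn, heq⟩ := edgeChain_of_up he
    rw [heq] at hp
    obtain ⟨k, k1, k2, rfl⟩ :=
      exists_of_mem_rowChain (List.drop_subset _ _ (List.dropLast_subset _ hp))
    exact ⟨k, (h1 _).trans k1, k2.trans (hn.trans_le (h2 _)), rfl⟩
  · rw [edgeChain_of_horiz he] at hp
    simp [chainBends] at hp

end Valid

end Layout

namespace Layout

variable {V : Type}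

/-- The layout `L`, moved up by one row, together with a bottom row holding two new vertices, a top
row holding one, and edges joining them at the abscissas `-M` and `M`. -/
def addFrame (L : Layout V) (h : ℤ) (M : ℝ) : Layout (V ⊕ Fin 3) where
  row := Sum.elim (fun v => L.row v + 1) ![1, 1, h + 2]
  x := Sum.elim L.x ![-M, M, 0]
  G :=
    { Adj := fun a b => match a, b with
        | Sum.inl u, Sum.inl v => L.G.Adj u v
        | Sum.inr i, Sum.inr j => (i = 2 ∧ j ≠ 2) ∨ (i ≠ 2 ∧ j = 2)
        | _, _ => False
      symm := ⟨by
        rintro (u | i) (v | j) hadj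
        · exact SimpleGraph.Adj.symm (G := L.G) hadj
        · exact hadj
        · exact hadj
        · exact hadj.symm.imp And.symm And.symm⟩
      loopless := ⟨by
        rintro (u | i) hadj
        · exact L.G.loopless.irrefl u hadj
        · rcases hadj with hadj | hadj
          · exact hadj.2 hadj.1
          · exact hadj.1 hadj.2⟩ }
  X e r := match e with
    | (Sum.inl u, Sum.inl v) => L.X (u, v) (r - 1)
    | (Sum.inr i, _) => if r = h + 2 then 0 else if i = 0 then -M else M
    | _ => 0

variable {L : Layout V} {h : ℤ} {M : ℝ}

lemma addFrame_up {e : (V ⊕ Fin 3) × (V ⊕ Fin 3)} (hh : 0 ≤ h) (he : (L.addFrame h M).Up e) :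
    (∃ u v, e = (Sum.inl u, Sum.inl v) ∧ L.Up (u, v)) ∨ e = (Sum.inr 0, Sum.inr 2) ∨
      e = (Sum.inr 1, Sum.inr 2) := by
  obtain ⟨u | i, v | j⟩ := e
  · refine Or.inl ⟨u, v, rfl, he.1, ?_⟩
    have := he.2
    simp only [addFrame, Sum.elim_inl] at this
    dsimp only; omega
  · exact he.1.elim
  · exact he.1.elim
  · right
    obtain ⟨hadj, h2⟩ := he
    have hij : (i = 2 ∧ j ≠ 2) ∨ (i ≠ 2 ∧ j = 2) := hadj
    simp only [addFrame, Sum.elim_inr] at h2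
    rcases hij with ⟨rfl, hij⟩ | ⟨hij, rfl⟩
    · fin_cases j
      · simp at h2; omega
      · simp at h2; omega
      · exact absurd rfl hij
    · fin_cases i
      · exact Or.inl rfl
      · exact Or.inr rfl
      · exact absurd rfl hij

theorem Valid.addFrame (hL : L.Valid) (hlo : ∀ v, 1 ≤ L.row v) (hhi : ∀ v, L.row v ≤ h)
    (hh : 0 ≤ h) (hM : 0 < M) (hx : ∀ v, |L.x v| < M)
    (hX : ∀ e r, 1 ≤ r → r ≤ h → |L.X e r| < M) : (L.addFrame h M).Valid := by
  set F := L.addFrame h M with hF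
  have Fup : ∀ e, F.Up e → (∃ u v, e = (Sum.inl u, Sum.inl v) ∧ L.Up (u, v)) ∨
      e = (Sum.inr 0, Sum.inr 2) ∨ e = (Sum.inr 1, Sum.inr 2) :=
    fun e he => addFrame_up hh he
  have r0 : F.row (Sum.inr 0) = 1 := rfl
  have r1 : F.row (Sum.inr 1) = 1 := rfl
  have r2 : F.row (Sum.inr 2) = h + 2 := rfl
  have x0 : F.x (Sum.inr 0) = -M := rfl
  have x1 : F.x (Sum.inr 1) = M := rfl
  have x2 : F.x (Sum.inr 2) = 0 := rfl
  have rl : ∀ v, F.row (Sum.inl v) = L.row v + 1 := fun _ => rfl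
  have xl : ∀ v, F.x (Sum.inl v) = L.x v := fun _ => rfl
  have Xl : ∀ u v r, F.X (Sum.inl u, Sum.inl v) r = L.X (u, v) (r - 1) := fun _ _ _ => rfl
  have X0 : ∀ r, r ≠ h + 2 → F.X (Sum.inr 0, Sum.inr 2) r = -M := fun r hr => by
    change (if r = h + 2 then 0 else if (0 : Fin 3) = 0 then -M else M) = -M
    rw [if_neg hr, if_pos rfl]
  have X1 : ∀ r, r ≠ h + 2 → F.X (Sum.inr 1, Sum.inr 2) r = M := fun r hr => by
    change (if r = h + 2 then 0 else if (1 : Fin 3) = 0 then -M else M) = M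
    rw [if_neg hr, if_neg (by decide)]
  have X02 : F.X (Sum.inr 0, Sum.inr 2) (h + 2) = 0 := if_pos rfl
  have X12 : F.X (Sum.inr 1, Sum.inr 2) (h + 2) = 0 := if_pos rfl
  have lpass : ∀ u v r, F.Pass (Sum.inl u, Sum.inl v) r → L.Pass (u, v) (r - 1) := by
    rintro u v r ⟨⟨k1, k2⟩, k3, k4⟩
    simp only [rl] at k2 k3 k4
    refine ⟨⟨k1, ?_⟩, ?_, ?_⟩ <;> dsimp only <;> omega
  have lspan : ∀ u v r, F.Spans (Sum.inl u, Sum.inl v) r → L.Spans (u, v) (r - 1) := by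
    rintro u v r ⟨⟨k1, k2⟩, k3, k4⟩
    simp only [rl] at k2 k3 k4
    refine ⟨⟨k1, ?_⟩, ?_, ?_⟩ <;> dsimp only <;> omega
  have fin_row : ∀ i : Fin 3, F.row (Sum.inr i) = 1 ∨ F.row (Sum.inr i) = h + 2 := by
    intro i; fin_cases i
    · exact Or.inl rfl
    · exact Or.inl rfl
    · exact Or.inr rfl
  have inl_of_row : ∀ w, 1 < F.row w → F.row w < h + 2 → ∃ v, w = Sum.inl v := by
    rintro (v | i) h1 h2
    · exact ⟨v, rfl⟩
    · rcases fin_row i with hi | hi <;> omega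
  have hor : ∀ a b, F.G.Adj a b → F.row a = F.row b →
      ∃ u v, a = Sum.inl u ∧ b = Sum.inl v ∧ L.G.Adj u v ∧ L.row u = L.row v := by
    rintro (u | i) (v | j) hadj hr
    · refine ⟨u, v, rfl, rfl, hadj, ?_⟩
      rw [rl, rl] at hr; omega
    · exact hadj.elim
    · exact hadj.elim
    · exfalso
      have h1 : (i = 2 ∧ j ≠ 2) ∨ (i ≠ 2 ∧ j = 2) := hadj
      fin_cases i <;> fin_cases j <;> simp at h1 <;> simp [r0, r1, r2] at hr <;> omega
  refine ⟨?_, ?_, ?_, ?_, ?_, ?_, ?_, ?_⟩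
  · rintro (u | i) (v | j) h1 h2
    · rw [hL.inj u v (by rw [rl, rl] at h1; omega) h2]
    · have := hlo u
      have := hhi u
      rw [rl] at h1
      rcases fin_row j with hj | hj <;> omega
    · have := hlo v
      have := hhi v
      rw [rl] at h1
      rcases fin_row i with hj | hj <;> omega
    · fin_cases i <;> fin_cases j <;> simp [r0, r1, r2] at h1 <;> simp [x0, x1, x2] at h2 <;>
        first | rfl | omega | linarith
  · intro e he
    rcases Fup e he with ⟨u, v, rfl, huv⟩ | rfl | rfl
    · simp only [Xl, rl, xl, add_sub_cancel_right]; exact hL.X_fst _ huv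
    · exact X0 1 (by omega)
    · exact X1 1 (by omega)
  · intro e he
    rcases Fup e he with ⟨u, v, rfl, huv⟩ | rfl | rfl
    · simp only [Xl, rl, xl, add_sub_cancel_right]; exact hL.X_snd _ huv
    · exact X02
    · exact X12
  · intro e w he
    rcases Fup e he.1 with ⟨u, v, rfl, huv⟩ | rfl | rfl
    · have h1 := he.2.1
      have h2 := he.2.2
      rw [rl] at h1 h2
      have := hlo u
      have := hhi v
      obtain ⟨w, rfl⟩ := inl_of_row w (by omega) (by omega)
      have h3 := lpass u v _ he
      rw [rl, add_sub_cancel_right] at h3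
      rw [Xl, rl, xl, add_sub_cancel_right]
      exact hL.pass_vertex _ w h3
    · obtain ⟨w, rfl⟩ := inl_of_row w he.2.1 he.2.2
      rw [X0 _ he.2.2.ne]
      exact (abs_lt.1 (hx w)).1.ne
    · obtain ⟨w, rfl⟩ := inl_of_row w he.2.1 he.2.2
      rw [X1 _ he.2.2.ne]
      exact (abs_lt.1 (hx w)).2.ne'
  · have lbound : ∀ u v r, F.Pass (Sum.inl u, Sum.inl v) r →
        |F.X (Sum.inl u, Sum.inl v) r| < M ∧ r ≠ h + 2 := by
      intro u v r hp
      have hp' := (lpass u v r hp).2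
      have := hlo u
      have := hhi v
      dsimp only at hp'
      exact ⟨hX _ _ (by omega) (by omega), by omega⟩
    intro e f r he hf hef
    rcases Fup e he.1 with ⟨u, v, rfl, -⟩ | rfl | rfl <;>
      rcases Fup f hf.1 with ⟨u', v', rfl, -⟩ | rfl | rfl
    · have := hL.pass_edge _ _ _ (lpass _ _ _ he) (lpass _ _ _ hf) hef
      rw [Prod.mk.injEq] at this
      rw [this.1, this.2]
    · obtain ⟨h1, h2⟩ := lbound u v r he
      rw [hef, X0 r h2, abs_neg] at h1
      exact absurd h1 (le_abs_self M).not_gt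
    · obtain ⟨h1, h2⟩ := lbound u v r he
      rw [hef, X1 r h2] at h1
      exact absurd h1 (le_abs_self M).not_gt
    · obtain ⟨h1, h2⟩ := lbound u' v' r hf
      rw [← hef, X0 r h2, abs_neg] at h1
      exact absurd h1 (le_abs_self M).not_gt
    · rfl
    · rw [X0 r he.2.2.ne, X1 r he.2.2.ne] at hef
      linarith
    · obtain ⟨h1, h2⟩ := lbound u' v' r hf
      rw [← hef, X1 r h2] at h1
      exact absurd h1 (le_abs_self M).not_gt
    · rw [X0 r he.2.2.ne, X1 r he.2.2.ne] at hef
      linarith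
    · rfl
  · have lbound : ∀ u v r, F.Spans (Sum.inl u, Sum.inl v) r →
        |F.X (Sum.inl u, Sum.inl v) r| < M ∧ |F.X (Sum.inl u, Sum.inl v) (r + 1)| < M ∧
          r ≠ h + 2 ∧ r + 1 ≠ h + 2 := by
      intro u v r hp
      have hp' := (lspan u v r hp).2
      have := hlo u
      have := hhi v
      dsimp only at hp'
      exact ⟨hX _ _ (by omega) (by omega), hX _ _ (by omega) (by omega), by omega, by omega⟩
    intro e f r he hf hef
    rcases Fup e he.1 with ⟨u, v, rfl, -⟩ | rfl | rfl <;>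
      rcases Fup f hf.1 with ⟨u', v', rfl, -⟩ | rfl | rfl
    · have := hL.cross _ _ _ (lspan _ _ _ he) (lspan _ _ _ hf) hef
      rw [Xl, Xl, add_sub_right_comm]
      exact this
    · obtain ⟨h1, -, h2, -⟩ := lbound u v r he
      rw [X0 r h2] at hef
      exact absurd hef (abs_lt.1 h1).1.not_gt
    · obtain ⟨-, h1, -, h2⟩ := lbound u v r he
      rw [X1 _ h2]
      exact (abs_lt.1 h1).2.le
    · obtain ⟨-, h1, -, h2⟩ := lbound u' v' r hf
      rw [X0 _ h2]
      exact (abs_lt.1 h1).1.le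
    · exact absurd hef (lt_irrefl _)
    · by_cases hr : r + 1 = h + 2
      · rw [hr, X02, X12]
      · rw [X0 _ hr, X1 _ hr]; linarith
    · obtain ⟨h1, -, h2, -⟩ := lbound u' v' r hf
      rw [X1 r h2] at hef
      exact absurd hef (abs_lt.1 h1).2.not_gt
    · rw [X0 r he.2.2.ne, X1 r he.2.2.ne] at hef
      linarith
    · exact absurd hef (lt_irrefl _)
  · intro a b w hadj hr hw hlt
    obtain ⟨u, v, rfl, rfl, h1, h2⟩ := hor a b hadj hr
    have := hlo u
    have := hhi u
    rw [rl] at hw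
    obtain ⟨w, rfl⟩ := inl_of_row w (by omega) (by omega)
    rw [rl] at hw
    exact hL.horiz_vertex u v w h1 h2 (by omega) hlt
  · intro a b e hadj hr he
    obtain ⟨u, v, rfl, rfl, h1, h2⟩ := hor a b hadj hr
    have := hlo u
    have := hhi u
    rcases Fup e he.1 with ⟨u', v', rfl, -⟩ | rfl | rfl
    · have h3 := lpass _ _ _ he
      rw [rl, add_sub_cancel_right] at h3
      rw [Xl, rl, xl, xl, add_sub_cancel_right]
      exact hL.horiz_edge u v _ h1 h2 h3
    · rw [X0 _ he.2.2.ne]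
      exact fun hlt => absurd hlt (abs_lt.1 (hx u)).1.not_gt
    · rw [X1 _ he.2.2.ne]
      exact fun _ => (abs_lt.1 (hx v)).2.le

theorem Valid.frame (hL : L.Valid) (hlo : ∀ v, 1 ≤ L.row v) (hhi : ∀ v, L.row v ≤ h)
    (hh : 0 ≤ h) (hM : 0 < M) (hx : ∀ v, |L.x v| < M)
    (hX : ∀ e r, 1 ≤ r → r ≤ h → |L.X e r| < M) :
    (L.addFrame h M).Frame 1 (h + 2) (Sum.inr 0) (Sum.inr 1) (Sum.inr 2) := by
  have hinl : ∀ w, 1 < (L.addFrame h M).row w → (L.addFrame h M).row w < h + 2 →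
      ∃ v, w = Sum.inl v := by
    rintro (v | i) h1 h2
    · exact ⟨v, rfl⟩
    · fin_cases i <;> simp [Layout.addFrame] at h1 h2
  refine ⟨hL.addFrame hlo hhi hh hM hx hX, ?_, ?_, rfl, rfl, rfl, ?_, ?_, ?_, ?_, ?_, ?_, ?_⟩
  · rintro (v | i)
    · have := hlo v
      simp only [Layout.addFrame, Sum.elim_inl]; omega
    · fin_cases i <;> simp [Layout.addFrame]
      omega
  · rintro (v | i)
    · have := hhi v
      simp only [Layout.addFrame, Sum.elim_inl]; omega
    · fin_cases i <;> simp [Layout.addFrame] <;> omega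
  · rintro (v | i) hr
    · have := hlo v
      simp only [Layout.addFrame, Sum.elim_inl] at hr; omega
    · fin_cases i
      · exact Or.inl rfl
      · exact Or.inr rfl
      · simp [Layout.addFrame] at hr; omega
  · rintro (v | i) hr
    · have := hhi v
      simp only [Layout.addFrame, Sum.elim_inl] at hr; omega
    · fin_cases i
      · simp [Layout.addFrame] at hr; omega
      · simp [Layout.addFrame] at hr; omega
      · rfl
  · change -M < M
    linarith
  · exact ⟨Or.inr ⟨by decide, rfl⟩, show (1 : ℤ) < h + 2 by omega⟩
  · exact ⟨Or.inr ⟨by decide, rfl⟩, show (1 : ℤ) < h + 2 by omega⟩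
  · intro w h1 h2
    obtain ⟨v, rfl⟩ := hinl w h1 h2
    have h3 : (L.addFrame h M).X (Sum.inr 0, Sum.inr 2) ((L.addFrame h M).row (Sum.inl v)) = -M :=
      (if_neg h2.ne).trans (if_pos rfl)
    rw [h3]
    exact (abs_lt.1 (hx v)).1
  · intro w h1 h2
    obtain ⟨v, rfl⟩ := hinl w h1 h2
    have h3 : (L.addFrame h M).X (Sum.inr 1, Sum.inr 2) ((L.addFrame h M).row (Sum.inl v)) = M :=
      (if_neg h2.ne).trans (if_neg (by decide))
    rw [h3]
    exact (abs_lt.1 (hx v)).2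

end Layout

lemma subset_chainSet : ∀ {l : List Pt} {p : Pt}, p ∈ l → p ∈ chainSet l
  | [q], p, h => by simpa [chainSet] using h
  | q :: r :: l, p, h => by
    rcases List.mem_cons.1 h with rfl | h
    · exact Or.inl (left_mem_segment ℝ _ _)
    · exact Or.inr (subset_chainSet h)

lemma ordConnected_rowSlice_of_convex {S : Set Pt} (hS : Convex ℝ S) (y : ℝ) :
    (rowSlice S y).OrdConnected := by
  refine ⟨fun x hx z hz w hw => ?_⟩
  rw [← segment_eq_Icc (hw.1.trans hw.2)] at hw
  obtain ⟨a, b, ha, hb, hab, rfl⟩ := hw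
  have := hS hx hz ha hb hab
  rw [Prod.smul_mk, Prod.smul_mk, Prod.mk_add_mk, ← add_smul, hab, one_smul] at this
  exact this

lemma mul_snd_le_of_mem_segment {s c : ℝ} {p q z : Pt} (hp : s * p.2 ≤ c) (hq : s * q.2 ≤ c)
    (hz : z ∈ segment ℝ p q) : s * z.2 ≤ c := by
  obtain ⟨a, b, ha, hb, hab, rfl⟩ := hz
  simp only [Prod.snd_add, Prod.smul_snd, smul_eq_mul]
  calc s * (a * p.2 + b * q.2) = a * (s * p.2) + b * (s * q.2) := by ring
    _ ≤ a * c + b * c := by gcongr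
    _ = c := by rw [← add_mul, hab, one_mul]

lemma le_mul_snd_of_mem_chainSet {s c : ℝ} : ∀ {l : List Pt},
    l.IsChain (fun p q => s * p.2 ≤ s * q.2) → (∀ p ∈ l.head?, c ≤ s * p.2) →
    ∀ z ∈ chainSet l, c ≤ s * z.2
  | [], _, _, z, hz => hz.elim
  | [p], _, hc, z, hz => by
    rw [show z = p from hz]
    exact hc p rfl
  | p :: q :: l, hl, hc, z, hz => by
    rw [List.isChain_cons_cons] at hl
    have hp := hc p rfl
    rcases hz with hz | hz
    · have := mul_snd_le_of_mem_segment (s := -s) (c := -c) (by linarith) (by linarith) hz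
      linarith
    · refine le_mul_snd_of_mem_chainSet hl.2 (fun r hr => ?_) z hz
      obtain rfl : q = r := Option.some.inj hr
      exact hp.trans hl.1

/-- Horizontal lines meet monotone polygonal chains in intervals. -/
lemma isPreconnected_rowSlice_chainSet {s : ℝ} (hs : s ≠ 0) (y : ℝ) : ∀ {l : List Pt},
    l.IsChain (fun p q => s * p.2 ≤ s * q.2) → IsPreconnected (rowSlice (chainSet l) y)
  | [], _ => isPreconnected_empty
  | [p], _ => by
    refine Set.Subsingleton.isPreconnected fun a ha b hb => ?_
    have ha : (a, y) = p := ha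
    have hb : (b, y) = p := hb
    exact (Prod.mk.inj (ha.trans hb.symm)).1
  | p :: q :: l, hl => by
    rw [List.isChain_cons_cons] at hl
    have h1 := (ordConnected_rowSlice_of_convex (convex_segment p q) y).isPreconnected
    have h2 := isPreconnected_rowSlice_chainSet hs y hl.2
    change IsPreconnected (rowSlice (segment ℝ p q) y ∪ rowSlice (chainSet (q :: l)) y)
    rcases (rowSlice (segment ℝ p q) y).eq_empty_or_nonempty with he | ⟨a, ha⟩
    · rwa [he, empty_union]
    rcases (rowSlice (chainSet (q :: l)) y).eq_empty_or_nonempty with he | ⟨b, hb⟩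
    · rwa [he, union_empty]
    have h3 : s * y ≤ s * q.2 := mul_snd_le_of_mem_segment hl.1 le_rfl ha
    have h4 : s * q.2 ≤ s * y := le_mul_snd_of_mem_chainSet hl.2 (fun r hr => by
      obtain rfl : q = r := Option.some.inj hr
      exact le_rfl) _ hb
    have h5 : (q.1, y) = q := Prod.ext rfl (mul_left_cancel₀ hs (le_antisymm h3 h4))
    refine IsPreconnected.union q.1 ?_ ?_ h1 h2
    · change (q.1, y) ∈ segment ℝ p q
      rw [h5]; exact right_mem_segment ℝ _ _
    · change (q.1, y) ∈ chainSet (q :: l)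
      rw [h5]; exact subset_chainSet List.mem_cons_self

lemma exists_mem_segment_snd {p q : Pt} {y : ℝ} (hp : p.2 ≤ y) (hq : y ≤ q.2) :
    ∃ x, (x, y) ∈ segment ℝ p q := by
  have hy : y ∈ segment ℝ p.2 q.2 := by rw [segment_eq_Icc (hp.trans hq)]; exact ⟨hp, hq⟩
  obtain ⟨a, b, ha, hb, hab, rfl⟩ := hy
  exact ⟨a * p.1 + b * q.1, a, b, ha, hb, hab, rfl⟩

lemma exists_segment_subset_segment {p q : Pt} {r : ℝ} (hp : p.2 ≤ r) (hq : r + 1 ≤ q.2) :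
    ∃ x₀ x₁ : ℝ, segment ℝ (x₀, r) (x₁, r + 1) ⊆ segment ℝ p q := by
  obtain ⟨x₀, h0⟩ := exists_mem_segment_snd hp (by linarith : r ≤ q.2)
  obtain ⟨x₁, h1⟩ := exists_mem_segment_snd (by linarith : p.2 ≤ r + 1) hq
  exact ⟨x₀, x₁, (convex_segment p q).segment_subset h0 h1⟩

/-- A polygonal chain with vertices on integer rows crosses every strip between its lowest and
highest row along a segment. -/
lemma exists_segment_subset_chainSet (r : ℤ) : ∀ {l : List Pt},
    (∀ p ∈ l, ∃ k : ℤ, p.2 = k) → (∃ p ∈ l, p.2 ≤ r) → (∃ p ∈ l, (r : ℝ) + 1 ≤ p.2) →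
    ∃ x₀ x₁ : ℝ, segment ℝ (x₀, (r : ℝ)) (x₁, (r : ℝ) + 1) ⊆ chainSet l
  | [], _, ⟨p, hp, _⟩, _ => by simp at hp
  | [p], _, ⟨a, ha, ha'⟩, ⟨b, hb, hb'⟩ => by
    rw [List.mem_singleton] at ha hb
    subst ha hb
    linarith
  | p :: q :: l, hl, ⟨a, ha, ha'⟩, ⟨b, hb, hb'⟩ => by
    have side : ∀ z ∈ p :: q :: l, z.2 ≤ r ∨ (r : ℝ) + 1 ≤ z.2 := by
      intro z hz
      obtain ⟨k, hk⟩ := hl z hz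
      rw [hk]
      rcases le_or_gt k r with h | h
      · exact Or.inl (by exact_mod_cast h)
      · exact Or.inr (by exact_mod_cast h)
    have key : (∃ a ∈ q :: l, a.2 ≤ r) → (∃ b ∈ q :: l, (r : ℝ) + 1 ≤ b.2) →
        ∃ x₀ x₁ : ℝ, segment ℝ (x₀, (r : ℝ)) (x₁, (r : ℝ) + 1) ⊆ chainSet (p :: q :: l) := by
      intro h1 h2
      obtain ⟨x₀, x₁, h⟩ := exists_segment_subset_chainSet r
        (fun z hz => hl z (List.mem_cons_of_mem _ hz)) h1 h2
      exact ⟨x₀, x₁, h.trans subset_union_right⟩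
    have hq : q ∈ q :: l := List.mem_cons_self
    rcases side p List.mem_cons_self with hp' | hp' <;>
      rcases side q (List.mem_cons_of_mem _ hq) with hq' | hq'
    · rcases List.mem_cons.1 hb with rfl | hb
      · linarith
      · exact key ⟨q, hq, hq'⟩ ⟨b, hb, hb'⟩
    · obtain ⟨x₀, x₁, h⟩ := exists_segment_subset_segment hp' hq'
      exact ⟨x₀, x₁, h.trans subset_union_left⟩
    · obtain ⟨x₀, x₁, h⟩ := exists_segment_subset_segment hq' hp'
      rw [segment_symm ℝ q p] at h
      exact ⟨x₀, x₁, h.trans subset_union_left⟩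
    · rcases List.mem_cons.1 ha with rfl | ha
      · linarith
      · exact key ⟨a, ha, ha'⟩ ⟨q, hq, hq'⟩

lemma exists_mem_inter_of_ordConnected {I J : Set ℝ} (hI : I.OrdConnected) (hJ : J.OrdConnected)
    {a a' b b' : ℝ} (ha : a ∈ I) (ha' : a' ∈ I) (hb : b ∈ J) (hb' : b' ∈ J) (hab : a ≤ b)
    (hba : b' ≤ a') : ∃ z, z ∈ I ∧ z ∈ J := by
  rcases le_total b a' with h | h
  · exact ⟨b, hI.out ha ha' ⟨hab, h⟩, hb⟩
  · exact ⟨a', ha', hJ.out hb' hb ⟨hba, h⟩⟩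

lemma exists_mem_inter_segment {x₀ x₁ y₀ y₁ r : ℝ} (h0 : x₀ < y₀) (h1 : y₁ < x₁) :
    ∃ z t : ℝ, 0 < t ∧ t < 1 ∧ (z, r + t) ∈ segment ℝ (x₀, r) (x₁, r + 1) ∧
      (z, r + t) ∈ segment ℝ (y₀, r) (y₁, r + 1) := by
  have hd : 0 < (y₀ - x₀) + (x₁ - y₁) := by linarith
  set t := (y₀ - x₀) / ((y₀ - x₀) + (x₁ - y₁)) with ht
  have ht0 : 0 < t := div_pos (by linarith) hd
  have ht1 : t < 1 := (div_lt_one hd).2 (by linarith)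
  have heq : t * ((y₀ - x₀) + (x₁ - y₁)) = y₀ - x₀ := div_mul_cancel₀ _ hd.ne'
  refine ⟨(1 - t) * x₀ + t * x₁, t, ht0, ht1, ⟨1 - t, t, by linarith, ht0.le, by ring, ?_⟩,
    ⟨1 - t, t, by linarith, ht0.le, by ring, ?_⟩⟩
  · simp only [Prod.smul_mk, Prod.mk_add_mk, smul_eq_mul]
    exact Prod.ext rfl (by ring)
  · simp only [Prod.smul_mk, Prod.mk_add_mk, smul_eq_mul]
    exact Prod.ext (by dsimp only; linarith) (by ring)

namespace PolyDrawing

variable {V : Type} {G : SimpleGraph V} {Γ : PolyDrawing G}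

lemma pos_mem_edgePts {u v : V} (h : G.Adj u v) :
    Γ.pos u ∈ Γ.edgePts s(u, v) ∧ Γ.pos v ∈ Γ.edgePts s(u, v) := by
  rcases Γ.arc_ends u v h with ⟨h1, h2⟩ | ⟨h1, h2⟩
  · exact ⟨subset_chainSet (List.mem_of_head? h1), subset_chainSet (List.mem_of_getLast? h2)⟩
  · exact ⟨subset_chainSet (List.mem_of_getLast? h2), subset_chainSet (List.mem_of_head? h1)⟩

lemma IsYMonotone.ordConnected_rowSlice (hΓ : Γ.IsYMonotone) {e : Sym2 V} (he : e ∈ G.edgeSet)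
    (y : ℝ) : (rowSlice (Γ.edgePts e) y).OrdConnected := by
  rw [← isPreconnected_iff_ordConnected]
  rcases hΓ e he with h | h
  · refine isPreconnected_rowSlice_chainSet (s := 1) one_ne_zero y ?_
    exact ((List.isChain_map _).1 h).imp fun p q hpq => by simpa using hpq
  · refine isPreconnected_rowSlice_chainSet (s := -1) (by norm_num) y ?_
    exact ((List.isChain_map _).1 h).imp fun p q hpq => by simpa using hpq

lemma exists_int_of_mem_arc {k : V → ℤ} (hk : ∀ v, (Γ.pos v).2 = k v)
    (hb : ∀ e ∈ G.edgeSet, ∀ p ∈ chainBends (Γ.arc e), ∃ k : ℤ, p.2 = (k : ℝ)) {u v : V}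
    (h : G.Adj u v) : ∀ p ∈ Γ.arc s(u, v), ∃ k : ℤ, p.2 = (k : ℝ) := by
  have key : ∀ l : List Pt, (∀ p ∈ l.head?, ∃ k : ℤ, p.2 = (k : ℝ)) →
      (∀ p ∈ l.getLast?, ∃ k : ℤ, p.2 = (k : ℝ)) →
      (∀ p ∈ chainBends l, ∃ k : ℤ, p.2 = (k : ℝ)) → ∀ p ∈ l, ∃ k : ℤ, p.2 = (k : ℝ) := by
    intro l h1 h2 h3 p hp
    cases l with
    | nil => simp at hp
    | cons a l =>
      rcases List.mem_cons.1 hp with rfl | hp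
      · exact h1 p rfl
      rcases List.eq_nil_or_concat l with rfl | ⟨l, b, rfl⟩
      · simp at hp
      · rcases List.mem_append.1 (by simpa using hp : p ∈ l ++ [b]) with hp | hp
        · exact h3 p (by simpa [chainBends] using hp)
        · rw [List.mem_singleton] at hp
          subst hp
          exact h2 p (by simp [List.getLast?_cons])
  have hpos : ∀ (o : Option Pt) w, o = some (Γ.pos w) → ∀ p ∈ o, ∃ k : ℤ, p.2 = (k : ℝ) := by
    rintro _ w rfl p hp
    obtain rfl := Option.some.inj hp
    exact ⟨k w, hk w⟩
  rcases Γ.arc_ends u v h with ⟨h1, h2⟩ | ⟨h1, h2⟩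
  · exact key _ (hpos _ _ h1) (hpos _ _ h2) (hb _ h)
  · exact key _ (hpos _ _ h1) (hpos _ _ h2) (hb _ h)

open Classical in
/-- The layout of a drawing with vertices on the rows given by `k`. -/
noncomputable def layout (Γ : PolyDrawing G) (k : V → ℤ) : Layout V where
  row := k
  x v := (Γ.pos v).1
  G := G
  X e r := if r = k e.1 then (Γ.pos e.1).1 else if r = k e.2 then (Γ.pos e.2).1 else
    if h : ∃ x : ℝ, (x, (r : ℝ)) ∈ Γ.edgePts s(e.1, e.2) then h.choose else 0

theorem valid_layout (hpl : Γ.IsPlanar) (hmono : Γ.IsYMonotone) {k : V → ℤ}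
    (hk : ∀ v, (Γ.pos v).2 = k v)
    (hb : ∀ e ∈ G.edgeSet, ∀ p ∈ chainBends (Γ.arc e), ∃ k : ℤ, p.2 = (k : ℝ)) :
    (Γ.layout k).Valid := by
  set L := Γ.layout k with hL
  have hpos : ∀ v, Γ.pos v = (L.x v, (L.row v : ℝ)) := fun v => Prod.ext rfl (hk v)
  have hfst : ∀ e, L.Up e → L.X e (L.row e.1) = L.x e.1 := fun e _ => if_pos rfl
  have hsnd : ∀ e, L.Up e → L.X e (L.row e.2) = L.x e.2 := fun e he =>
    (if_neg he.2.ne').trans (if_pos rfl)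
  have hstrip : ∀ e r, L.Spans e r → ∃ x₀ x₁ : ℝ,
      segment ℝ (x₀, (r : ℝ)) (x₁, (r : ℝ) + 1) ⊆ Γ.edgePts s(e.1, e.2) := by
    intro e r he
    have hint := exists_int_of_mem_arc hk hb he.1.1
    have hmem : Γ.pos e.1 ∈ Γ.arc s(e.1, e.2) ∧ Γ.pos e.2 ∈ Γ.arc s(e.1, e.2) := by
      rcases Γ.arc_ends e.1 e.2 he.1.1 with ⟨h1, h2⟩ | ⟨h1, h2⟩
      · exact ⟨List.mem_of_head? h1, List.mem_of_getLast? h2⟩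
      · exact ⟨List.mem_of_getLast? h2, List.mem_of_head? h1⟩
    refine exists_segment_subset_chainSet r hint ⟨_, hmem.1, ?_⟩ ⟨_, hmem.2, ?_⟩
    · rw [hk]; exact_mod_cast he.2.1
    · rw [hk]; exact_mod_cast he.2.2
  have hX : ∀ e r, L.Up e → L.row e.1 ≤ r → r ≤ L.row e.2 →
      L.X e r ∈ rowSlice (Γ.edgePts s(e.1, e.2)) r := by
    intro e r he h1 h2
    have hp := pos_mem_edgePts (Γ := Γ) he.1
    rcases h1.eq_or_lt with rfl | h1
    · rw [hfst e he]
      have := hp.1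
      rwa [hpos] at this
    rcases h2.eq_or_lt with rfl | h2
    · rw [hsnd e he]
      have := hp.2
      rwa [hpos] at this
    have hex : ∃ x : ℝ, (x, (r : ℝ)) ∈ Γ.edgePts s(e.1, e.2) := by
      obtain ⟨x₀, x₁, h⟩ := hstrip e r ⟨he, h1.le, h2⟩
      exact ⟨x₀, h (left_mem_segment ℝ _ _)⟩
    have heq : L.X e r = hex.choose :=
      (if_neg h1.ne').trans ((if_neg h2.ne).trans (dif_pos hex))
    rw [heq]
    exact hex.choose_spec
  have hadj : ∀ {e}, L.Up e → s(e.1, e.2) ∈ G.edgeSet := fun he => he.1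
  have hvertex : ∀ {s : Sym2 V} {w : V}, s ∈ G.edgeSet →
      L.x w ∈ rowSlice (Γ.edgePts s) (L.row w) → w ∈ s := by
    intro s w hs hw
    by_contra hws
    refine hpl.1 w s hs hws ?_
    rw [hpos]
    exact hw
  have hmeet : ∀ {s s' : Sym2 V} {z y : ℝ}, s ∈ G.edgeSet → s' ∈ G.edgeSet → s ≠ s' →
      (z, y) ∈ Γ.edgePts s → (z, y) ∈ Γ.edgePts s' →
      ∃ w, w ∈ s ∧ w ∈ s' ∧ y = L.row w := by
    intro s s' z y hs hs' hne h1 h2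
    obtain ⟨w, h3, h4, h5⟩ := hpl.2 s hs s' hs' hne _ ⟨h1, h2⟩
    rw [hpos] at h5
    exact ⟨w, h3, h4, (Prod.mk.inj h5).2⟩
  have hne : ∀ {e f}, L.Up e → L.Up f → e ≠ f → s(e.1, e.2) ≠ s(f.1, f.2) := by
    intro e f he hf hef h
    rcases Sym2.eq_iff.1 h with ⟨h1, h2⟩ | ⟨h1, h2⟩
    · exact hef (Prod.ext h1 h2)
    · have h3 := he.2
      have h4 := hf.2
      rw [h1, h2] at h3
      exact lt_asymm h3 h4
  refine ⟨?_, hfst, hsnd, ?_, ?_, ?_, ?_, ?_⟩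
  · intro u v h1 h2
    refine Γ.pos_inj ?_
    rw [hpos, hpos, h1, h2]
  · intro e w he heq
    have h1 := hX e _ he.1 he.2.1.le he.2.2.le
    rw [heq] at h1
    rcases Sym2.mem_iff.1 (hvertex (hadj he.1) h1) with rfl | rfl
    · exact lt_irrefl _ he.2.1
    · exact lt_irrefl _ he.2.2
  · intro e f r he hf heq
    by_contra hef
    have h1 := hX e r he.1 he.2.1.le he.2.2.le
    have h2 := hX f r hf.1 hf.2.1.le hf.2.2.le
    rw [← heq] at h2
    obtain ⟨w, h3, -, h5⟩ := hmeet (hadj he.1) (hadj hf.1) (hne he.1 hf.1 hef) h1 h2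
    have h5 : r = L.row w := by exact_mod_cast h5
    rcases Sym2.mem_iff.1 h3 with rfl | rfl
    · exact he.2.1.ne' h5
    · exact he.2.2.ne h5
  · intro e f r he hf hlt
    by_contra! hgt
    have hef : e ≠ f := by rintro rfl; exact lt_irrefl _ hlt
    have hs := hne he.1 hf.1 hef
    obtain ⟨x₀, x₁, hx⟩ := hstrip e r he
    obtain ⟨y₀, y₁, hy⟩ := hstrip f r hf
    have h0 : x₀ < y₀ := by
      by_contra! hle
      obtain ⟨z, h1, h2⟩ := exists_mem_inter_of_ordConnected
        (hmono.ordConnected_rowSlice (hadj he.1) r) (hmono.ordConnected_rowSlice (hadj hf.1) r)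
        (hX e r he.1 he.2.1 he.2.2.le) (hx (left_mem_segment ℝ _ _))
        (hX f r hf.1 hf.2.1 hf.2.2.le) (hy (left_mem_segment ℝ _ _)) hlt.le hle
      obtain ⟨w, h3, h4, h5⟩ := hmeet (hadj he.1) (hadj hf.1) hs h1 h2
      have h5 : r = L.row w := by exact_mod_cast h5
      rcases Sym2.mem_iff.1 h3 with rfl | rfl
      · rcases Sym2.mem_iff.1 h4 with h4 | h4
        · rw [h5, hfst e he.1, h4, hfst f hf.1] at hlt
          exact lt_irrefl _ hlt
        · exact hf.2.2.ne (h5.trans (congrArg _ h4))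
      · exact he.2.2.ne h5
    have h1 : y₁ < x₁ := by
      by_contra! hle
      have hc : ((r + 1 : ℤ) : ℝ) = (r : ℝ) + 1 := by push_cast; rfl
      have h6 := hX e (r + 1) he.1 (by have := he.2.1; omega) he.2.2
      have h7 := hX f (r + 1) hf.1 (by have := hf.2.1; omega) hf.2.2
      rw [hc] at h6 h7
      obtain ⟨z, h1, h2⟩ := exists_mem_inter_of_ordConnected
        (hmono.ordConnected_rowSlice (hadj hf.1) _) (hmono.ordConnected_rowSlice (hadj he.1) _)
        h7 (hy (right_mem_segment ℝ _ _)) h6 (hx (right_mem_segment ℝ _ _)) hgt.le hle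
      obtain ⟨w, h3, h4, h5⟩ := hmeet (hadj hf.1) (hadj he.1) hs.symm h1 h2
      have h5 : r + 1 = L.row w := by exact_mod_cast h5
      have h8 := he.2.1
      have h9 := hf.2.1
      rcases Sym2.mem_iff.1 h3 with rfl | rfl
      · omega
      · rcases Sym2.mem_iff.1 h4 with h4 | h4
        · rw [h4] at h5
          omega
        · rw [h5, hsnd f hf.1, h4, hsnd e he.1] at hgt
          exact lt_irrefl _ hgt
    obtain ⟨z, t, ht0, ht1, hz, hz'⟩ := exists_mem_inter_segment (r := r) h0 h1
    obtain ⟨w, -, -, h5⟩ := hmeet (hadj he.1) (hadj hf.1) hs (hx hz) (hy hz')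
    exact Layout.Valid.int_ne ht0 ht1 h5
  · intro u v w huv hr hw hlt
    by_contra! hgt
    have hp := pos_mem_edgePts (Γ := Γ) huv
    rw [hpos, hpos, ← hr, ← hw] at hp
    rcases Sym2.mem_iff.1 (hvertex huv ((hmono.ordConnected_rowSlice (e := s(u, v)) huv _).out
      hp.1 hp.2 ⟨hlt.le, hgt.le⟩)) with rfl | rfl
    · exact lt_irrefl _ hlt
    · exact lt_irrefl _ hgt
  · intro u v e huv hr he hlt
    by_contra! hgt
    have hp := pos_mem_edgePts (Γ := Γ) huv
    rw [hpos, hpos, ← hr] at hp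
    have h1 := (hmono.ordConnected_rowSlice (e := s(u, v)) huv _).out
      hp.1 hp.2 ⟨hlt.le, hgt.le⟩
    have h2 := hX e _ he.1 he.2.1.le he.2.2.le
    have hs : s(u, v) ≠ s(e.1, e.2) := by
      intro h
      have h3 := he.1.2
      rcases Sym2.eq_iff.1 h with ⟨rfl, rfl⟩ | ⟨rfl, rfl⟩ <;> omega
    obtain ⟨w, -, h4, h5⟩ := hmeet huv (hadj he.1) hs h1 h2
    have h5 : L.row u = L.row w := by exact_mod_cast h5
    rcases Sym2.mem_iff.1 h4 with rfl | rfl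
    · exact he.2.1.ne' h5
    · exact he.2.2.ne h5

end PolyDrawing

lemma exists_abs_bound {ι : Type*} [Finite ι] (f : ι → ℝ) : ∃ M, ∀ i, |f i| < M := by
  obtain ⟨M, hM⟩ := (Set.finite_range fun i => |f i|).bddAbove
  exact ⟨M + 1, fun i => lt_of_le_of_lt (hM ⟨i, rfl⟩) (lt_add_one M)⟩

/-- Any planar `y`-monotone poly-line drawing of height `h` of a
graph `G` can be extended: there is a triangulated graph `G'` obtained from `G` by
adding three new vertices and additional edges, with a planar `y`-monotone poly-line
drawing of height `h + 2` in which each original vertex keeps its `x`-coordinate and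
has its `y`-coordinate increased by exactly one. -/
theorem stmt17 {V : Type} [Fintype V] (G : SimpleGraph V) (h : ℕ)
    (Γ : PolyDrawing G) (hpl : Γ.IsPlanar) (hmono : Γ.IsYMonotone)
    (hht : Γ.HasHeight h) :
    ∃ G' : SimpleGraph (V ⊕ Fin 3),
      (∀ u v : V, G.Adj u v → G'.Adj (Sum.inl u) (Sum.inl v)) ∧
      IsTriangulated G' ∧
      ∃ Γ' : PolyDrawing G', Γ'.IsPlanar ∧ Γ'.IsYMonotone ∧ Γ'.HasHeight (h + 2) ∧
        ∀ v : V, Γ'.pos (Sum.inl v) = ((Γ.pos v).1, (Γ.pos v).2 + 1) := by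
  choose k hlo hhi hk using hht.1
  have hL : (Γ.layout k).Valid := PolyDrawing.valid_layout hpl hmono hk fun e he p hp => by
    obtain ⟨j, -, -, hj⟩ := hht.2 e he p hp
    exact ⟨j, hj⟩
  obtain ⟨A, hA⟩ := exists_abs_bound (Γ.layout k).x
  obtain ⟨B, hB⟩ := exists_abs_bound
    fun q : (V × V) × Icc (1 : ℤ) h => (Γ.layout k).X q.1 q.2
  set M := max 1 (max A B) with hM
  have hAM : A ≤ M := (le_max_left _ _).trans (le_max_right _ _)
  have hBM : B ≤ M := (le_max_right _ _).trans (le_max_right _ _)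
  have hF := hL.frame (M := M) hlo hhi (Int.natCast_nonneg h)
    (lt_of_lt_of_le one_pos (le_max_left _ _)) (fun v => (hA v).trans_le hAM)
    (fun e r h1 h2 => (hB (e, ⟨r, h1, h2⟩)).trans_le hBM)
  obtain ⟨G', X, hG, hFr⟩ := hF.exists_framed
  have hV := hFr.toValid
  have hcard : Fintype.card (V ⊕ Fin 3) = Fintype.card V + 3 := by simp
  have hedges := hFr.ncard_edgeSet
  refine ⟨G', fun u v huv => hG huv, ⟨by omega, ?_, hV.drawing, hV.drawing_isPlanar⟩,
    hV.drawing, hV.drawing_isPlanar, hV.drawing_isYMonotone,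
    hV.drawing_hasHeight hF.lo_le fun w => ?_, fun v => ?_⟩
  · dsimp only at hedges
    omega
  · exact_mod_cast hF.le_hi w
  · refine Prod.ext rfl ?_
    change ((k v + 1 : ℤ) : ℝ) = (Γ.pos v).2 + 1
    rw [hk]
    push_cast
    rfl
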